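/- Let u be a weak supersolution of ∂ₜu + 𝓛u = Δu in Ω × (0,T) with u ≥ 0 on B_R(x₀) × (τ₁, τ₂ + τ), where τ > 0, τ₁ < τ₂, and B_R(x₀) × (τ₁, τ₂ + τ) ⊂ Ω × (0,T). Let 0 < r ≤ 1 with r < R, let l > 0, set v = u + l, let 0 < α < 1 and put ζ₂(1−α) = 4(1−α)/α + 9/(1−α). Then for every nonnegative ψ ∈ C_c^∞(B_r(x₀)) and every nonnegative η ∈ C^∞(ℝ) satisfying η(t) = 1 for τ₁ ≤ t ≤ τ₂ and η(t) = 0 for t ≥ τ₂ + τ one has: ∫_{τ₁}^{τ₂+τ} ∫_{B_r(x₀)} |∇(v^{α/2})(x,t)|² ψ(x)² η(t) dx dt ≤ (α²/(1−α)) [ ζ₂(1−α) ∫_{τ₁}^{τ₂+τ} ∫_{B_r(x₀)} ∫_{B_r(x₀)} (ψ(x) − ψ(y))² (v(x,t)^α + v(y,t)^α) η(t) K(x,y,t) dx dy dt + 2Λ ( sup_{x ∈ supp ψ} ∫_{ℝ^N ∖ B_r(x₀)} |x − y|^{−(N+2s)} dy ) ∫_{τ₁}^{τ₂+τ} ∫_{B_r(x₀)}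 v(x,t)^α ψ(x)² η(t) dx dt + (2Λ/l) ( esssup_{τ₁ < t < τ₂+τ} sup_{x ∈ supp ψ} ∫_{ℝ^N ∖ B_R(x₀)} u₋(y,t) |x − y|^{−(N+2s)} dy ) ∫_{τ₁}^{τ₂+τ} ∫_{B_r(x₀)} v(x,t)^α ψ(x)² η(t) dx dt + (2/(1−α)) ∫_{τ₁}^{τ₂+τ} ∫_{B_r(x₀)} v(x,t)^α |∇ψ(x)|² η(t) dx dt + (1/α) ∫_{τ₁}^{τ₂+τ} ∫_{B_r(x₀)} v(x,t)^α ψ(x)² |η'(t)| dx dt ]. -/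

import Mathlib

open MeasureTheory Metric Set
open scoped RealInnerProductSpace ENNReal

noncomputable section

/-- Euclidean space `ℝ^N`. -/
abbrev E (N : ℕ) : Type := EuclideanSpace ℝ (Fin N)

/-- The kernel `K` is measurable, symmetric in its first two arguments, and comparable to
the fractional kernel `|x-y|^{-(N+2s)}` with constant `Λ`, uniformly for `t ∈ (0,T)`. -/
def KernelOK (N : ℕ) (s Λ T : ℝ) (K : E N → E N → ℝ → ℝ) : Prop :=
  Measurable (fun p : E N × E N × ℝ => K p.1 p.2.1 p.2.2) ∧
  (∀ x y t, K x y t = K y x t) ∧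
  ∀ x y : E N, x ≠ y → ∀ t ∈ Set.Ioo 0 T,
    Λ⁻¹ * ‖x - y‖ ^ (-((N : ℝ) + 2 * s)) ≤ K x y t ∧
      K x y t ≤ Λ * ‖x - y‖ ^ (-((N : ℝ) + 2 * s))

/-- `u` is a (bounded, measurable, smooth in `Ω × (0,T)`) weak supersolution of
`∂ₜ u + 𝓛 u = Δ u` in `Ω × (0,T)`. -/
def IsWeakSupersolution (N : ℕ) (T : ℝ) (K : E N → E N → ℝ → ℝ)
    (Ω : Set (E N)) (u : E N → ℝ → ℝ) : Prop :=
  Measurable (fun p : E N × ℝ => u p.1 p.2) ∧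
  (∃ M : ℝ, ∀ x t, t ∈ Set.Ioo 0 T → |u x t| ≤ M) ∧
  ContDiffOn ℝ (⊤ : ℕ∞) (fun p : E N × ℝ => u p.1 p.2) (Ω ×ˢ Set.Ioo 0 T) ∧
  ∀ φ : E N → ℝ → ℝ,
    ContDiff ℝ (⊤ : ℕ∞) (fun p : E N × ℝ => φ p.1 p.2) →
    HasCompactSupport (fun p : E N × ℝ => φ p.1 p.2) →
    tsupport (fun p : E N × ℝ => φ p.1 p.2) ⊆ Ω ×ˢ Set.Ioo 0 T →
    (∀ x t, 0 ≤ φ x t) →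
    0 ≤ -(∫ t in Set.Ioo 0 T, ∫ x in Ω, u x t * deriv (fun τ => φ x τ) t) +
        (∫ t in Set.Ioo 0 T, ∫ x in Ω,
          ⟪gradient (fun y => u y t) x, gradient (fun y => φ y t) x⟫) +
        ∫ t in Set.Ioo 0 T, ∫ x : E N, ∫ y : E N,
          (u x t - u y t) * (φ x t - φ y t) * K x y t

/-- The negative part `u₋ = max(-u, 0)`. -/
def uminus (N : ℕ) (u : E N → ℝ → ℝ) : E N → ℝ → ℝ := fun x t => max (-(u x t)) 0

/-- The parabolic tail `Tail_∞(w; x₀, ρ, t₁, t₂)`. -/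
def tailInfty (N : ℕ) (s : ℝ) (w : E N → ℝ → ℝ) (x₀ : E N) (ρ t₁ t₂ : ℝ) : ℝ :=
  ρ ^ 2 * essSup
      (fun t => ∫ y in (Metric.ball x₀ ρ)ᶜ, |w y t| * ‖y - x₀‖ ^ (-((N : ℝ) + 2 * s)))
      (volume.restrict (Set.Ioo t₁ t₂))

lemma rpow_conv (a b α : ℝ) (hb : 0 < b) (hab : b ≤ a) (h0 : 0 < α) (h1 : α < 1) :
    a ^ (α - 1) * (1 + (1 - α) * ((a - b) / a)) ≤ b ^ (α - 1) := by
  have ha : 0 < a := lt_of_lt_of_le hb hab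
  set z := (a - b) / a with hz
  have hz0 : 0 ≤ z := div_nonneg (by linarith) ha.le
  have hz1 : z < 1 := by rw [hz, div_lt_one ha]; linarith
  have hbz : b = a * (1 - z) := by rw [hz]; field_simp; ring
  have h := _root_.rpow_one_add_le_one_add_mul_self (s := -z) (by linarith) (p := 1 - α)
    (by linarith) (by linarith)
  have hpos : 0 < (1 + -z) ^ (1 - α) := Real.rpow_pos_of_pos (by linarith) _
  have h2 : (1 - z) ^ (α - 1) = ((1 + -z) ^ (1 - α))⁻¹ := by
    rw [← Real.rpow_neg (by linarith)]; congr 1; ring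
  rw [hbz, Real.mul_rpow ha.le (by linarith), h2]
  apply mul_le_mul_of_nonneg_left _ (Real.rpow_nonneg ha.le _)
  rw [← one_div, le_div_iff₀ hpos]
  have : 0 ≤ (1-α) * z := mul_nonneg (by linarith) hz0
  nlinarith [mul_le_mul_of_nonneg_left h (show 0 ≤ 1 + (1-α) * z by linarith), sq_nonneg ((1-α)*z)]

lemma alg_ineq_aux (a b p q α : ℝ) (hb : 0 < b) (hab : b ≤ a)
    (h0 : 0 < α) (h1 : α < 1) :
    (a - b) * (a ^ (α - 1) * p ^ 2 - b ^ (α - 1) * q ^ 2) ≤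
      (4 * (1 - α) / α + 9 / (1 - α)) * ((p - q) ^ 2 * (a ^ α + b ^ α)) := by
  have ha : 0 < a := lt_of_lt_of_le hb hab
  have hc := rpow_conv a b α hb hab h0 h1
  have hA : 0 < a ^ (α - 1) := Real.rpow_pos_of_pos ha _
  have hAa : a ^ α = a ^ (α - 1) * a := by
    rw [Real.rpow_sub_one ha.ne']; field_simp
  have hB : 0 < b ^ α := Real.rpow_pos_of_pos hb _
  set A := a ^ (α - 1)
  set z := (a - b) / a with hz
  have hz0 : 0 ≤ z := div_nonneg (by linarith) ha.le
  have hz1 : z ≤ 1 := by rw [hz, div_le_one ha]; linarith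
  have hab' : a - b = z * a := by rw [hz]; field_simp
  have hβ : 0 < 1 - α := by linarith
  have key : z * (p ^ 2 - q ^ 2 * (1 + (1 - α) * z)) ≤ (1 + 1 / (1 - α)) * (p - q) ^ 2 := by
    have h3 : 2 * (q * (p - q) * z) ≤ (1 - α) * (q * z) ^ 2 + (p - q) ^ 2 / (1 - α) := by
      have := sq_nonneg ((1 - α) * (q * z) - (p - q))
      have h4 : 0 ≤ ((1 - α) * (q * z) - (p - q)) ^ 2 / (1 - α) := by positivity
      have h5 : ((1 - α) * (q * z) - (p - q)) ^ 2 / (1 - α) =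
        (1 - α) * (q * z) ^ 2 + (p - q) ^ 2 / (1 - α) - 2 * (q * (p - q) * z) := by
        field_simp; ring
      linarith
    have h6 : (1 + 1 / (1 - α)) * (p - q) ^ 2 = (p - q) ^ 2 + (p - q) ^ 2 / (1 - α) := by ring
    rw [h6]
    nlinarith [mul_le_mul_of_nonneg_right hz1 (sq_nonneg (p - q))]
  have hcoef : 1 + 1 / (1 - α) ≤ 4 * (1 - α) / α + 9 / (1 - α) := by
    have h7 : 0 < 4 * (1 - α) / α := by positivity
    have h8 : 1 ≤ 1 / (1 - α) := by rw [le_div_iff₀ hβ]; linarith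
    have h9 : 9 / (1 - α) = 9 * (1 / (1 - α)) := by ring
    linarith
  calc (a - b) * (A * p ^ 2 - b ^ (α - 1) * q ^ 2)
      ≤ (a - b) * (A * p ^ 2 - A * (1 + (1 - α) * z) * q ^ 2) := by
        apply mul_le_mul_of_nonneg_left _ (by linarith)
        have := mul_le_mul_of_nonneg_right hc (sq_nonneg q)
        linarith
    _ = A * a * (z * (p ^ 2 - q ^ 2 * (1 + (1 - α) * z))) := by rw [hab']; ring
    _ ≤ A * a * ((1 + 1 / (1 - α)) * (p - q) ^ 2) := by
        apply mul_le_mul_of_nonneg_left key (by positivity)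
    _ = (1 + 1 / (1 - α)) * ((p - q) ^ 2 * a ^ α) := by rw [hAa]; ring
    _ ≤ _ := by
        apply mul_le_mul hcoef _ _ _
        · apply mul_le_mul_of_nonneg_left _ (sq_nonneg _)
          linarith
        · rw [hAa]; positivity
        · positivity

lemma alg_ineq (a b p q α : ℝ) (ha : 0 < a) (hb : 0 < b) (h0 : 0 < α) (h1 : α < 1) :
    (a - b) * (a ^ (α - 1) * p ^ 2 - b ^ (α - 1) * q ^ 2) ≤
      (4 * (1 - α) / α + 9 / (1 - α)) * ((p - q) ^ 2 * (a ^ α + b ^ α)) := by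
  rcases le_total b a with h | h
  · exact alg_ineq_aux a b p q α hb h h0 h1
  · have := alg_ineq_aux b a q p α ha h h0 h1
    calc _ = (b - a) * (b ^ (α - 1) * q ^ 2 - a ^ (α - 1) * p ^ 2) := by ring
      _ ≤ _ := this
      _ = _ := by ring

/-- The truncated kernel. -/
def kap (N : ℕ) (s : ℝ) (z : E N) : ℝ := min 1 (‖z‖ ^ 2) * ‖z‖ ^ (-((N : ℝ) + 2 * s))

lemma kap_nonneg (N : ℕ) (s : ℝ) (z : E N) : 0 ≤ kap N s z := by
  unfold kap; positivity

lemma kap_neg (N : ℕ) (s : ℝ) (z : E N) : kap N s (-z) = kap N s z := by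
  unfold kap; rw [norm_neg]

lemma kap_integrable (N : ℕ) (hN : 2 ≤ N) (s : ℝ) (hs0 : 0 < s) (hs1 : s < 1) :
    Integrable (kap N s) := by
  have : Nonempty (Fin N) := ⟨⟨0, by omega⟩⟩
  have h := (integrable_fun_norm_addHaar (volume : Measure (E N))
    (f := fun y : ℝ => min 1 (y ^ 2) * y ^ (-((N : ℝ) + 2 * s)))).2 ?_
  · exact h
  · rw [show (Ioi (0:ℝ)) = Ioc 0 1 ∪ Ioi 1 from (Ioc_union_Ioi_eq_Ioi zero_le_one).symm]
    have hdim : Module.finrank ℝ (E N) = N := by simp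
    have hpow : ∀ y : ℝ, 0 < y → y ^ (N - 1) = y ^ ((N : ℝ) - 1) := by
      intro y hy
      rw [← Real.rpow_natCast]
      congr 1
      rw [Nat.cast_sub (by omega)]; simp
    apply IntegrableOn.union
    · have h1 : IntegrableOn (fun y : ℝ => y ^ (1 - 2 * s)) (Ioc 0 1) := by
        have := intervalIntegral.intervalIntegrable_rpow' (a := 0) (b := 1)
          (r := 1 - 2 * s) (by linarith)
        rwa [intervalIntegrable_iff_integrableOn_Ioc_of_le zero_le_one] at this
      apply h1.congr_fun _ measurableSet_Ioc
      intro y hy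
      simp only [hdim, smul_eq_mul]
      rw [hpow y hy.1, min_eq_right (by nlinarith [hy.1, hy.2]), ← Real.rpow_natCast,
        ← Real.rpow_add hy.1, ← Real.rpow_add hy.1]
      congr 1; push_cast; ring
    · have h1 : IntegrableOn (fun y : ℝ => y ^ (-1 - 2 * s)) (Ioi 1) :=
        integrableOn_Ioi_rpow_of_lt (by linarith) one_pos
      apply h1.congr_fun _ measurableSet_Ioi
      intro y hy
      have hy' : (1:ℝ) < y := hy
      have hy0 : 0 < y := by linarith
      simp only [hdim, smul_eq_mul]
      rw [hpow y hy0, min_eq_left (by nlinarith), one_mul, ← Real.rpow_add hy0]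
      congr 1; ring

/-- gluing lemma for continuity -/
lemma glue_cont {X : Type*} [TopologicalSpace X] {F : X → ℝ} {U C : Set X}
    (hU : IsOpen U) (hC : IsClosed C) (hCU : C ⊆ U)
    (hF : ContinuousOn F U) (h0 : ∀ p, p ∉ C → F p = 0) : Continuous F := by
  rw [continuous_iff_continuousAt]
  intro p
  by_cases hp : p ∈ U
  · exact hF.continuousAt (hU.mem_nhds hp)
  · have hpC : p ∈ Cᶜ := fun h => hp (hCU h)
    have : F =ᶠ[nhds p] fun _ => 0 := by
      filter_upwards [hC.isOpen_compl.mem_nhds hpC] with q hq using h0 q hq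
    exact continuousAt_const.congr this.symm

lemma glue_smooth {X : Type*} [NormedAddCommGroup X] [NormedSpace ℝ X] {F : X → ℝ} {U C : Set X}
    (hU : IsOpen U) (hC : IsClosed C) (hCU : C ⊆ U)
    (hF : ContDiffOn ℝ (⊤ : ℕ∞) F U) (h0 : ∀ p, p ∉ C → F p = 0) :
    ContDiff ℝ (⊤ : ℕ∞) F := by
  rw [contDiff_iff_contDiffAt]
  intro p
  by_cases hp : p ∈ U
  · exact hF.contDiffAt (hU.mem_nhds hp)
  · have hpC : p ∈ Cᶜ := fun h => hp (hCU h)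
    have : F =ᶠ[nhds p] fun _ => 0 := by
      filter_upwards [hC.isOpen_compl.mem_nhds hpC] with q hq using h0 q hq
    exact contDiffAt_const.congr_of_eventuallyEq this

lemma glue_integrable {N : ℕ} {F : E N × ℝ → ℝ} {U C : Set (E N × ℝ)}
    (hU : IsOpen U) (hC : IsCompact C) (hCU : C ⊆ U)
    (hF : ContinuousOn F U) (h0 : ∀ p, p ∉ C → F p = 0) : Integrable F := by
  have hc := glue_cont hU hC.isClosed hCU hF h0
  exact hc.integrable_of_hasCompactSupport (HasCompactSupport.intro hC h0)

/-- The test function. -/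
def tst {N : ℕ} (u : E N → ℝ → ℝ) (l α : ℝ) (ψ : E N → ℝ) (χ : ℝ → ℝ) (x : E N) (t : ℝ) : ℝ :=
  (u x t + l) ^ (α - 1) * (ψ x ^ 2 * χ t)

/-- Local data: `u` is smooth and nonnegative on `B × J`, `ψ` and `χ` are cut-offs. -/
structure Loc (N : ℕ) (u : E N → ℝ → ℝ) (l α : ℝ) (ψ : E N → ℝ) (χ : ℝ → ℝ)
    (B : Set (E N)) (J : Set ℝ) : Prop where
  hB : IsOpen B
  hJ : IsOpen J
  hl : 0 < l
  h0 : 0 < α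
  h1 : α < 1
  hu : ContDiffOn ℝ (⊤ : ℕ∞) (fun p : E N × ℝ => u p.1 p.2) (B ×ˢ J)
  hpos : ∀ x ∈ B, ∀ t ∈ J, 0 ≤ u x t
  hψ : ContDiff ℝ (⊤ : ℕ∞) ψ
  hψc : HasCompactSupport ψ
  hψB : tsupport ψ ⊆ B
  hχ : ContDiff ℝ (⊤ : ℕ∞) χ
  hχc : HasCompactSupport χ
  hχJ : tsupport χ ⊆ J
  hχ0 : ∀ t, 0 ≤ χ t

lemma full_int {N : ℕ} {F : E N → ℝ → ℝ} {A : Set (E N)} {J : Set ℝ}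
    (h : ∀ x t, (x ∉ A ∨ t ∉ J) → F x t = 0) :
    ∫ t in J, ∫ x in A, F x t = ∫ t, ∫ x, F x t := by
  rw [setIntegral_eq_integral_of_forall_compl_eq_zero]
  · congr 1; ext t
    exact setIntegral_eq_integral_of_forall_compl_eq_zero (fun x hx => h x t (Or.inl hx))
  · intro t ht
    simp [h _ t (Or.inr ht)]

lemma int_add {N : ℕ} {F G : ℝ → E N → ℝ} (hF : Integrable (fun q : ℝ × E N => F q.1 q.2))
    (hG : Integrable (fun q : ℝ × E N => G q.1 q.2)) :
    ∫ t, ∫ x, (F t x + G t x) = (∫ t, ∫ x, F t x) + ∫ t, ∫ x, G t x :=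
  integral_integral_add hF hG

lemma grad_cont {N : ℕ} {f : E N × ℝ → ℝ} {U : Set (E N × ℝ)} (hU : IsOpen U)
    (hf : ContDiffOn ℝ (⊤ : ℕ∞) f U) :
    ContinuousOn (fun p : E N × ℝ => gradient (fun y => f (y, p.2)) p.1) U := by
  have h1 : ContinuousOn (fderiv ℝ f) U := hf.continuousOn_fderiv_of_isOpen hU (by simp)
  have h2 : ContinuousOn (fun p : E N × ℝ => (InnerProductSpace.toDual ℝ (E N)).symm
      ((fderiv ℝ f p).comp (ContinuousLinearMap.inl ℝ (E N) ℝ))) U := by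
    apply (InnerProductSpace.toDual ℝ (E N)).symm.continuous.comp_continuousOn
    exact h1.clm_comp continuousOn_const
  apply h2.congr
  intro p hp
  have hd : DifferentiableAt ℝ f p := (hf.contDiffAt (hU.mem_nhds hp)).differentiableAt (by simp)
  have : HasFDerivAt (fun y : E N => f (y, p.2))
      ((fderiv ℝ f p).comp (ContinuousLinearMap.inl ℝ (E N) ℝ)) p.1 :=
    HasFDerivAt.comp (g := f) p.1 hd.hasFDerivAt (hasFDerivAt_prodMk_left p.1 p.2)
  simp only [gradient]
  rw [this.fderiv]

namespace Loc
variable {N : ℕ} {u : E N → ℝ → ℝ} {l α : ℝ} {ψ : E N → ℝ} {χ : ℝ → ℝ}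
    {B : Set (E N)} {J : Set ℝ}

lemma vpos (L : Loc N u l α ψ χ B J) {x : E N} {t : ℝ} (hx : x ∈ B) (ht : t ∈ J) :
    0 < u x t + l := by
  have := L.hpos x hx t ht
  have := L.hl
  linarith

lemma isOpen (L : Loc N u l α ψ χ B J) : IsOpen (B ×ˢ J) := L.hB.prod L.hJ

lemma vsmooth (L : Loc N u l α ψ χ B J) (β : ℝ) :
    ContDiffOn ℝ (⊤ : ℕ∞) (fun p : E N × ℝ => (u p.1 p.2 + l) ^ β) (B ×ˢ J) :=
  (L.hu.add contDiffOn_const).rpow_const_of_ne (fun _ hp => (L.vpos hp.1 hp.2).ne')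

lemma compactC (L : Loc N u l α ψ χ B J) : IsCompact (tsupport ψ ×ˢ tsupport χ) :=
  IsCompact.prod L.hψc L.hχc

lemma subC (L : Loc N u l α ψ χ B J) : tsupport ψ ×ˢ tsupport χ ⊆ B ×ˢ J :=
  prod_mono L.hψB L.hχJ

lemma zeroC {x : E N} {t : ℝ} (h : (x, t) ∉ tsupport ψ ×ˢ tsupport χ) : ψ x = 0 ∨ χ t = 0 := by
  by_contra hc
  push Not at hc
  exact h ⟨subset_tsupport _ hc.1, subset_tsupport _ hc.2⟩

lemma cut_smooth (L : Loc N u l α ψ χ B J) :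
    ContDiff ℝ (⊤ : ℕ∞) (fun p : E N × ℝ => ψ p.1 ^ 2 * χ p.2) :=
  ((L.hψ.comp contDiff_fst).pow 2).mul (L.hχ.comp contDiff_snd)

lemma mul_smooth (L : Loc N u l α ψ χ B J) {f : E N × ℝ → ℝ}
    (hf : ContDiffOn ℝ (⊤ : ℕ∞) f (B ×ˢ J)) :
    ContDiff ℝ (⊤ : ℕ∞) (fun p : E N × ℝ => f p * (ψ p.1 ^ 2 * χ p.2)) := by
  apply glue_smooth L.isOpen L.compactC.isClosed L.subC (hf.mul L.cut_smooth.contDiffOn)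
  rintro ⟨x, t⟩ hp
  rcases zeroC hp with h | h <;> simp [h]

lemma tst_smooth (L : Loc N u l α ψ χ B J) :
    ContDiff ℝ (⊤ : ℕ∞) (fun p : E N × ℝ => tst u l α ψ χ p.1 p.2) :=
  L.mul_smooth (L.vsmooth (α - 1))

lemma mul_supp {f : E N × ℝ → ℝ} :
    Function.support (fun p : E N × ℝ => f p * (ψ p.1 ^ 2 * χ p.2)) ⊆
      tsupport ψ ×ˢ tsupport χ := by
  rintro ⟨x, t⟩ hp
  by_contra hc
  apply hp
  rcases zeroC hc with h | h <;> simp [h]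

lemma tst_supp (L : Loc N u l α ψ χ B J) :
    tsupport (fun p : E N × ℝ => tst u l α ψ χ p.1 p.2) ⊆ tsupport ψ ×ˢ tsupport χ :=
  closure_minimal mul_supp L.compactC.isClosed

lemma tst_cpt (L : Loc N u l α ψ χ B J) :
    HasCompactSupport (fun p : E N × ℝ => tst u l α ψ χ p.1 p.2) :=
  L.compactC.of_isClosed_subset (isClosed_tsupport _) L.tst_supp

lemma tst_nonneg (L : Loc N u l α ψ χ B J) (x : E N) (t : ℝ) : 0 ≤ tst u l α ψ χ x t := by
  by_cases h : (x, t) ∈ tsupport ψ ×ˢ tsupport χ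
  · have h' := L.subC h
    have := L.vpos h'.1 h'.2
    have := L.hχ0 t
    unfold tst; positivity
  · unfold tst
    rcases zeroC h with h | h <;> simp [h]

lemma time_eq (L : Loc N u l α ψ χ B J) {Ω A : Set (E N)} {T : ℝ} (hBΩ : B ⊆ Ω)
    (hA : tsupport ψ ⊆ A) (hJT : J ⊆ Ioo 0 T) :
    (∫ t in Ioo 0 T, ∫ x in Ω, u x t * deriv (fun τ => tst u l α ψ χ x τ) t) =
      (1 / α) * ∫ t in J, ∫ x in A, (u x t + l) ^ α * ψ x ^ 2 * deriv χ t := by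
  set f : E N × ℝ → ℝ := fun p => u p.1 p.2 * (u p.1 p.2 + l) ^ (α - 1) -
    (1 / α) * (u p.1 p.2 + l) ^ α with hf
  have hfs : ContDiffOn ℝ (⊤ : ℕ∞) f (B ×ˢ J) :=
    (L.hu.mul (L.vsmooth _)).sub (contDiffOn_const.mul (L.vsmooth _))
  set W : E N × ℝ → ℝ := fun p => f p * (ψ p.1 ^ 2 * χ p.2) with hW
  have hWs : ContDiff ℝ (⊤ : ℕ∞) W := L.mul_smooth hfs
  have hWc : HasCompactSupport W :=
    L.compactC.of_isClosed_subset (isClosed_tsupport _)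
      (closure_minimal mul_supp L.compactC.isClosed)
  have hdχ : ∀ t, t ∉ tsupport χ → deriv χ t = 0 := fun t ht => by
    by_contra hc
    exact ht (support_deriv_subset hc)
  have hψ0 : ∀ x, x ∉ tsupport ψ → ψ x = 0 := fun x hx => image_eq_zero_of_notMem_tsupport hx
  have hχe : ∀ t, t ∉ tsupport χ → χ =ᶠ[nhds t] fun _ => 0 := fun t ht =>
    notMem_tsupport_iff_eventuallyEq.1 ht
  -- derivative of W
  have hWd : ∀ p : E N × ℝ, HasDerivAt (fun τ => W (p.1, τ)) (fderiv ℝ W p (0, 1)) p.2 := by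
    intro p
    have hd : HasFDerivAt W (fderiv ℝ W p) (p.1, p.2) :=
      (hWs.differentiable (by simp) p).hasFDerivAt
    exact hd.comp_hasDerivAt p.2 ((hasDerivAt_const p.2 p.1).prodMk (hasDerivAt_id p.2))
  have hF1c : Continuous (fun p => fderiv ℝ W p (0, 1)) :=
    (hWs.continuous_fderiv (by simp)).clm_apply continuous_const
  have hF1i : Integrable (fun p => fderiv ℝ W p (0, 1)) := by
    apply hF1c.integrable_of_hasCompactSupport
    exact hWc.fderiv_apply ℝ (0, 1)
  have hF2i : Integrable (fun p : E N × ℝ =>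
      (1 / α) * ((u p.1 p.2 + l) ^ α * ψ p.1 ^ 2 * deriv χ p.2)) := by
    apply glue_integrable L.isOpen L.compactC L.subC
    · apply continuousOn_const.mul
      apply ((L.vsmooth α).continuousOn.mul _).mul
      · exact ((L.hχ.continuous_deriv (by simp)).comp continuous_snd).continuousOn
      · exact ((L.hψ.continuous.comp continuous_fst).pow 2).continuousOn
    · rintro ⟨x, t⟩ hp
      simp only [mem_prod, not_and_or] at hp
      rcases hp with h | h
      · simp [hψ0 x h]
      · simp [hdχ t h]
  have hpt : ∀ x t, u x t * deriv (fun τ => tst u l α ψ χ x τ) t =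
      fderiv ℝ W (x, t) (0, 1) + (1 / α) * ((u x t + l) ^ α * ψ x ^ 2 * deriv χ t) := by
    intro x t
    rw [← (hWd (x, t)).deriv]
    by_cases hx : x ∈ tsupport ψ
    swap
    · simp [hW, tst, hψ0 x hx]
    by_cases ht : t ∈ tsupport χ
    swap
    · have e1 : (fun τ => tst u l α ψ χ x τ) =ᶠ[nhds t] fun _ => 0 := by
        filter_upwards [hχe t ht] with τ hτ
        simp [tst, hτ]
      have e2 : (fun τ => W (x, τ)) =ᶠ[nhds t] fun _ => 0 := by
        filter_upwards [hχe t ht] with τ hτ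
        simp [hW, hτ]
      rw [e1.deriv_eq, e2.deriv_eq, hdχ t ht]
      simp
    have hxB := L.hψB hx
    have htJ := L.hχJ ht
    have hv := L.vpos hxB htJ
    have hud : HasDerivAt (fun τ => u x τ) (deriv (fun τ => u x τ) t) t := by
      have h1 : DifferentiableAt ℝ (fun p : E N × ℝ => u p.1 p.2) (x, t) :=
        (L.hu.contDiffAt (L.isOpen.mem_nhds ⟨hxB, htJ⟩)).differentiableAt (by simp)
      exact (h1.hasFDerivAt.comp_hasDerivAt t
        ((hasDerivAt_const t x).prodMk (hasDerivAt_id t))).differentiableAt.hasDerivAt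
    have hχd : HasDerivAt χ (deriv χ t) t :=
      (L.hχ.differentiable (by simp) t).hasDerivAt
    have hp1 := (hud.add_const l).rpow_const (p := α - 1) (Or.inl hv.ne')
    have hp2 := (hud.add_const l).rpow_const (p := α) (Or.inl hv.ne')
    have hcut := hχd.const_mul (ψ x ^ 2)
    have d1 := (hp1.mul hcut).deriv
    have d2 := (((hud.mul hp1).sub (hp2.const_mul (1 / α))).mul hcut).deriv
    have e1 : deriv (fun τ => tst u l α ψ χ x τ) t = _ := d1
    have e2 : deriv (fun τ => W (x, τ)) t = _ := d2
    rw [e1, e2]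
    have hα := L.h0.ne'
    have : (u x t + l) ^ α = (u x t + l) ^ (α - 1) * (u x t + l) := by
      rw [Real.rpow_sub_one hv.ne']; field_simp
    simp only [Pi.mul_apply, Pi.sub_apply]
    rw [this]
    field_simp
    ring
  rw [full_int]
  · rw [full_int (A := A)]
    · rw [← integral_const_mul]
      simp_rw [← integral_const_mul, hpt]
      rw [int_add (F := fun t x => fderiv ℝ W (x, t) (0, 1))
        (G := fun t x => 1 / α * ((u x t + l) ^ α * ψ x ^ 2 * deriv χ t)) hF1i.swap hF2i.swap]
      rw [integral_integral_swap (f := fun t x => fderiv ℝ W (x, t) (0, 1)) hF1i.swap]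
      have hz : ∀ x, ∫ t, fderiv ℝ W (x, t) (0, 1) = 0 := by
        intro x
        have hcs : HasCompactSupport (fun τ => W (x, τ)) := by
          apply HasCompactSupport.intro L.hχc
          intro τ hτ
          simp [hW, image_eq_zero_of_notMem_tsupport hτ]
        have hcs' : HasCompactSupport (fun τ => fderiv ℝ W (x, τ) (0, 1)) := by
          have h3 := hcs.deriv
          have : deriv (fun τ => W (x, τ)) = fun τ => fderiv ℝ W (x, τ) (0, 1) := by
            ext τ; exact (hWd (x, τ)).deriv
          rwa [this] at h3
        apply integral_eq_zero_of_hasDerivAt_of_integrable (f := fun τ => W (x, τ))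
        · intro τ; exact hWd (x, τ)
        · exact (hF1c.comp (Continuous.prodMk_right x)).integrable_of_hasCompactSupport hcs'
        · exact (hWs.continuous.comp (Continuous.prodMk_right x)).integrable_of_hasCompactSupport hcs
      simp [hz]
    · rintro x t (h | h)
      · have h9 := hψ0 x (fun hh => h (hA hh)); simp [h9]
      · have h9 := hdχ t (fun hh => h (L.hχJ hh)); simp [h9]
  · rintro x t (h | h)
    · have : ψ x = 0 := hψ0 x (fun hh => h (hBΩ (L.hψB hh)))
      simp [tst, this]
    · have ht : t ∉ tsupport χ := fun hh => h (hJT (L.hχJ hh))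
      have e1 : (fun τ => tst u l α ψ χ x τ) =ᶠ[nhds t] fun _ => 0 := by
        filter_upwards [hχe t ht] with τ hτ
        simp [tst, hτ]
      rw [e1.deriv_eq]; simp

lemma grad_pt (L : Loc N u l α ψ χ B J) {x : E N} {t : ℝ} (hx : x ∈ B) (ht : t ∈ J) :
    ⟪gradient (fun y => u y t) x, gradient (fun y => tst u l α ψ χ y t) x⟫ ≤
      -(2 * (1 - α) / α ^ 2) *
        (‖gradient (fun y => (u y t + l) ^ (α / 2)) x‖ ^ 2 * ψ x ^ 2 * χ t) +
      (2 / (1 - α)) * ((u x t + l) ^ α * ‖gradient ψ x‖ ^ 2 * χ t) := by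
  have hv := L.vpos hx ht
  have h1 : DifferentiableAt ℝ (fun p : E N × ℝ => u p.1 p.2) (x, t) :=
    (L.hu.contDiffAt (L.isOpen.mem_nhds ⟨hx, ht⟩)).differentiableAt (by simp)
  have hud : DifferentiableAt ℝ (fun y => u y t) x :=
    DifferentiableAt.comp (g := fun p : E N × ℝ => u p.1 p.2) (f := fun y : E N => (y, t)) x h1
      (hasFDerivAt_prodMk_left x t).differentiableAt
  have hug := hud.hasGradientAt.hasFDerivAt
  have hψg := (L.hψ.differentiable (by simp) x).hasGradientAt.hasFDerivAt
  set gu := gradient (fun y => u y t) x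
  set gψ := gradient ψ x
  have hp1 := (hug.add_const l).rpow_const (p := α - 1) (Or.inl hv.ne')
  have hp2 := (hug.add_const l).rpow_const (p := α / 2) (Or.inl hv.ne')
  have hcut := (hψg.pow 2).mul_const (χ t)
  have e1 : HasGradientAt (fun y => tst u l α ψ χ y t)
      ((χ t * (α - 1) * (u x t + l) ^ (α - 2) * ψ x ^ 2) • gu +
        (2 * χ t * (u x t + l) ^ (α - 1) * ψ x) • gψ) x := by
    rw [hasGradientAt_iff_hasFDerivAt]
    have := hp1.mul hcut
    refine this.congr_fderiv ?_
    ext w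
    simp [show α - 1 - 1 = α - 2 by ring]
    ring
  have e2 : HasGradientAt (fun y => (u y t + l) ^ (α / 2))
      (((α / 2) * (u x t + l) ^ (α / 2 - 1)) • gu) x := by
    rw [hasGradientAt_iff_hasFDerivAt]
    refine hp2.congr_fderiv ?_
    ext w
    simp
  rw [e1.gradient, e2.gradient, inner_add_right, inner_smul_right, inner_smul_right,
    real_inner_self_eq_norm_sq, norm_smul]
  set V := u x t + l
  have hA : 0 < V ^ (α - 2) := Real.rpow_pos_of_pos hv _
  have r1 : V ^ (α - 1) = V ^ (α - 2) * V := by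
    rw [show α - 2 = α - 1 - 1 by ring, Real.rpow_sub_one hv.ne' (α - 1)]; field_simp
  have r2 : V ^ α = V ^ (α - 2) * V * V := by
    rw [← r1, Real.rpow_sub_one hv.ne' α]; field_simp
  have r3 : (V ^ (α / 2 - 1)) ^ 2 = V ^ (α - 2) := by
    rw [← Real.rpow_natCast, ← Real.rpow_mul hv.le]; congr 1; push_cast; ring
  have hχ0 := L.hχ0 t
  have hα := L.h0
  have hβ : 0 < 1 - α := by linarith [L.h1]
  have hcs : ψ x * V * ⟪gu, gψ⟫ ≤ |ψ x| * V * (‖gu‖ * ‖gψ‖) := by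
    calc ψ x * V * ⟪gu, gψ⟫ ≤ |ψ x * V * ⟪gu, gψ⟫| := le_abs_self _
      _ = |ψ x| * V * |⟪gu, gψ⟫| := by rw [abs_mul, abs_mul, abs_of_pos hv]
      _ ≤ _ := by
        apply mul_le_mul_of_nonneg_left (abs_real_inner_le_norm _ _) (by positivity)
  have key : 2 * (ψ x * V * ⟪gu, gψ⟫) ≤
      (1 - α) / 2 * (‖gu‖ ^ 2 * ψ x ^ 2) + (2 / (1 - α)) * (V * V * ‖gψ‖ ^ 2) := by
    have h4 : 0 ≤ ((1 - α) * (|ψ x| * ‖gu‖) - 2 * (V * ‖gψ‖)) ^ 2 / (2 * (1 - α)) := by positivity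
    have h5 : ((1 - α) * (|ψ x| * ‖gu‖) - 2 * (V * ‖gψ‖)) ^ 2 / (2 * (1 - α)) =
        (1 - α) / 2 * (‖gu‖ ^ 2 * |ψ x| ^ 2) + (2 / (1 - α)) * (V * V * ‖gψ‖ ^ 2) -
          2 * (|ψ x| * V * (‖gu‖ * ‖gψ‖)) := by
      field_simp; ring
    rw [sq_abs] at h5
    linarith
  have key2 := mul_le_mul_of_nonneg_left key (mul_nonneg hχ0 hA.le)
  rw [mul_pow, Real.norm_eq_abs, sq_abs, mul_pow, r3, r2, r1]
  have h6 : -(2 * (1 - α) / α ^ 2) * ((α / 2) ^ 2 * V ^ (α - 2) * ‖gu‖ ^ 2 * ψ x ^ 2 * χ t) =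
      -((1 - α) / 2) * (V ^ (α - 2) * ‖gu‖ ^ 2 * ψ x ^ 2 * χ t) := by
    field_simp
  rw [h6]
  linarith

lemma grad_int (L : Loc N u l α ψ χ B J) :
    Integrable (fun p : E N × ℝ =>
      ‖gradient (fun y => (u y p.2 + l) ^ (α / 2)) p.1‖ ^ 2 * ψ p.1 ^ 2 * χ p.2) := by
  apply glue_integrable L.isOpen L.compactC L.subC
  · apply (ContinuousOn.mul _ _).mul
    · exact (L.hχ.continuous.comp continuous_snd).continuousOn
    · exact ((grad_cont L.isOpen (L.vsmooth (α / 2))).norm).pow 2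
    · exact ((L.hψ.continuous.comp continuous_fst).pow 2).continuousOn
  · rintro ⟨x, t⟩ hp
    rcases zeroC hp with h | h <;> simp [h]

lemma grad_le (L : Loc N u l α ψ χ B J) {Ω A : Set (E N)} {T : ℝ} (hBΩ : B ⊆ Ω)
    (hA : tsupport ψ ⊆ A) (hJT : J ⊆ Ioo 0 T) :
    (∫ t in Ioo 0 T, ∫ x in Ω,
          ⟪gradient (fun y => u y t) x, gradient (fun y => tst u l α ψ χ y t) x⟫) ≤
      -(2 * (1 - α) / α ^ 2) * (∫ t in J, ∫ x in A,
        ‖gradient (fun y => (u y t + l) ^ (α / 2)) x‖ ^ 2 * ψ x ^ 2 * χ t) +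
      (2 / (1 - α)) * ∫ t in J, ∫ x in A, (u x t + l) ^ α * ‖gradient ψ x‖ ^ 2 * χ t := by
  have hgψ : ∀ x, x ∉ tsupport ψ → gradient ψ x = 0 := fun x hx => by
    rw [(notMem_tsupport_iff_eventuallyEq.1 hx).gradient_eq]
    exact gradient_fun_const _ _
  have hψ0 : ∀ x, x ∉ tsupport ψ → ψ x = 0 := fun x hx => image_eq_zero_of_notMem_tsupport hx
  have hχ0 : ∀ x, x ∉ tsupport χ → χ x = 0 := fun x hx => image_eq_zero_of_notMem_tsupport hx
  have hgt : ∀ x t, (x ∉ tsupport ψ ∨ t ∉ tsupport χ) →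
      gradient (fun y => tst u l α ψ χ y t) x = 0 := by
    rintro x t (h | h)
    · have : (fun y => tst u l α ψ χ y t) =ᶠ[nhds x] fun _ => 0 := by
        filter_upwards [notMem_tsupport_iff_eventuallyEq.1 h] with y hy
        simp [tst, hy]
      rw [this.gradient_eq]
      exact gradient_fun_const _ _
    · simp only [tst, hχ0 t h, mul_zero]
      exact gradient_fun_const _ _
  have iG := L.grad_int
  have iP : Integrable (fun p : E N × ℝ => (u p.1 p.2 + l) ^ α * ‖gradient ψ p.1‖ ^ 2 * χ p.2) := by
    apply glue_integrable L.isOpen L.compactC L.subC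
    · apply ((L.vsmooth α).continuousOn.mul _).mul
      · exact (L.hχ.continuous.comp continuous_snd).continuousOn
      · have hc : Continuous (gradient ψ) :=
          (InnerProductSpace.toDual ℝ (E N)).symm.continuous.comp
            (L.hψ.continuous_fderiv (by simp))
        exact ((hc.comp continuous_fst).norm.pow 2).continuousOn
    · rintro ⟨x, t⟩ hp
      simp only [mem_prod, not_and_or] at hp
      rcases hp with h | h
      · simp [hgψ x h]
      · simp [hχ0 t h]
  have iI : Integrable (fun p : E N × ℝ => ⟪gradient (fun y => u y p.2) p.1,
      gradient (fun y => tst u l α ψ χ y p.2) p.1⟫) := by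
    apply glue_integrable L.isOpen L.compactC L.subC
    · exact (grad_cont L.isOpen L.hu).inner (grad_cont L.isOpen L.tst_smooth.contDiffOn)
    · rintro ⟨x, t⟩ hp
      simp only [mem_prod, not_and_or] at hp
      simp only
      rw [hgt x t hp, inner_zero_right]
  rw [full_int, full_int, full_int, ← integral_const_mul, ← integral_const_mul]
  · simp_rw [← integral_const_mul]
    rw [← int_add
      (F := fun t x => -(2 * (1 - α) / α ^ 2) *
        (‖gradient (fun y => (u y t + l) ^ (α / 2)) x‖ ^ 2 * ψ x ^ 2 * χ t))
      (G := fun t x => (2 / (1 - α)) * ((u x t + l) ^ α * ‖gradient ψ x‖ ^ 2 * χ t))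
      (iG.swap.const_mul _) (iP.swap.const_mul _)]
    have iS : Integrable (fun q : ℝ × E N => -(2 * (1 - α) / α ^ 2) *
        (‖gradient (fun y => (u y q.1 + l) ^ (α / 2)) q.2‖ ^ 2 * ψ q.2 ^ 2 * χ q.1) +
        (2 / (1 - α)) * ((u q.2 q.1 + l) ^ α * ‖gradient ψ q.2‖ ^ 2 * χ q.1)) :=
      (iG.swap.const_mul (-(2 * (1 - α) / α ^ 2))).add (iP.swap.const_mul (2 / (1 - α)))
    rw [integral_integral (f := fun t x => ⟪gradient (fun y => u y t) x,
      gradient (fun y => tst u l α ψ χ y t) x⟫) iI.swap]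
    rw [integral_integral (f := fun t x => -(2 * (1 - α) / α ^ 2) *
        (‖gradient (fun y => (u y t + l) ^ (α / 2)) x‖ ^ 2 * ψ x ^ 2 * χ t) +
        (2 / (1 - α)) * ((u x t + l) ^ α * ‖gradient ψ x‖ ^ 2 * χ t)) iS]
    apply integral_mono iI.swap iS
    rintro ⟨t, x⟩
    by_cases hp : x ∈ tsupport ψ ∧ t ∈ tsupport χ
    · exact L.grad_pt (L.hψB hp.1) (L.hχJ hp.2)
    · rw [not_and_or] at hp
      have h7 := hgt x t hp
      simp only [Function.comp_apply, Prod.swap_prod_mk]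
      rw [h7, inner_zero_right]
      rcases hp with h | h
      · simp [hgψ x h, hψ0 x h]
      · simp [hχ0 t h]
  · rintro x t (h | h)
    · have h9 := hgψ x (fun hh => h (hA hh)); simp [h9]
    · have h9 := hχ0 t (fun hh => h (L.hχJ hh)); simp [h9]
  · rintro x t (h | h)
    · have h9 := hψ0 x (fun hh => h (hA hh)); simp [h9]
    · have h9 := hχ0 t (fun hh => h (L.hχJ hh)); simp [h9]
  · rintro x t h
    rw [hgt x t, inner_zero_right]
    exact h.imp (fun h hh => h (hBΩ (L.hψB hh))) (fun h hh => h (hJT (L.hχJ hh)))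

end Loc

/-- Majorant on `E × E`. -/
def kk (N : ℕ) (s : ℝ) (A : Set (E N)) (q : E N × E N) : ℝ :=
  (A.indicator (fun _ => (1 : ℝ)) q.1 + A.indicator (fun _ => (1 : ℝ)) q.2) * kap N s (q.1 - q.2)

lemma ind_nonneg {N : ℕ} (A : Set (E N)) (x : E N) : 0 ≤ A.indicator (fun _ => (1 : ℝ)) x :=
  indicator_nonneg (fun _ _ => zero_le_one) x

lemma kk_nonneg (N : ℕ) (s : ℝ) (A : Set (E N)) (q : E N × E N) : 0 ≤ kk N s A q :=
  mul_nonneg (add_nonneg (ind_nonneg _ _) (ind_nonneg _ _)) (kap_nonneg _ _ _)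

lemma kap_le_kk_left {N : ℕ} {s : ℝ} {A : Set (E N)} {x y : E N} (hx : x ∈ A) :
    kap N s (x - y) ≤ kk N s A (x, y) := by
  unfold kk
  simp only [indicator_of_mem hx]
  have := ind_nonneg A y
  have := kap_nonneg N s (x - y)
  nlinarith

lemma kap_le_kk_right {N : ℕ} {s : ℝ} {A : Set (E N)} {x y : E N} (hy : y ∈ A) :
    kap N s (x - y) ≤ kk N s A (x, y) := by
  unfold kk
  simp only [indicator_of_mem hy]
  have := ind_nonneg A x
  have := kap_nonneg N s (x - y)
  nlinarith

lemma kk_integrable (N : ℕ) (hN : 2 ≤ N) (s : ℝ) (hs0 : 0 < s) (hs1 : s < 1) {A : Set (E N)}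
    (hA : MeasurableSet A) (hAf : volume A ≠ ⊤) : Integrable (kk N s A) := by
  have hi : Integrable (A.indicator (fun _ => (1 : ℝ))) :=
    (integrable_indicator_iff hA).2 (integrableOn_const hAf)
  have h1 := Integrable.convolution_integrand (ContinuousLinearMap.mul ℝ ℝ) (μ := volume)
    hi (kap_integrable N hN s hs0 hs1)
  have h2 := h1.swap
  have h3 := h2.add h1
  refine h3.congr (Filter.Eventually.of_forall ?_)
  rintro ⟨x, y⟩
  simp only [Pi.add_apply, Function.comp_apply, Prod.swap_prod_mk, ContinuousLinearMap.mul_apply', kk]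
  rw [← kap_neg N s (y - x), neg_sub]
  ring

lemma le_biSup_real {X : Type*} {f : X → ℝ} {S : Set X} {C : ℝ} (hC : ∀ x ∈ S, f x ≤ C)
    {x : X} (hx : x ∈ S) : f x ≤ ⨆ x ∈ S, f x := by
  have hb : BddAbove (range fun x => ⨆ (_ : x ∈ S), f x) := by
    refine ⟨max C 0, ?_⟩
    rintro _ ⟨y, rfl⟩
    simp only
    by_cases hy : y ∈ S
    · rw [ciSup_pos hy]; exact le_max_of_le_left (hC y hy)
    · have : IsEmpty (y ∈ S) := ⟨hy⟩
      rw [Real.iSup_of_isEmpty]; exact le_max_right _ _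
  refine le_trans ?_ (le_ciSup hb x)
  rw [ciSup_pos hx]

lemma biSup_le_real {X : Type*} {f : X → ℝ} {S : Set X} {C : ℝ} (hC : ∀ x ∈ S, f x ≤ C)
    (hC0 : 0 ≤ C) : (⨆ x ∈ S, f x) ≤ C := by
  apply Real.iSup_le _ hC0
  intro y
  exact Real.iSup_le (fun hy => hC y hy) hC0

lemma biSup_nonneg_real {X : Type*} {f : X → ℝ} {S : Set X} (hf : ∀ x, 0 ≤ f x) :
    0 ≤ ⨆ x ∈ S, f x :=
  Real.iSup_nonneg (fun x => Real.iSup_nonneg (fun _ => hf x))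

/-- Global data. -/
structure Glob (N : ℕ) (s Λ T : ℝ) (K : E N → E N → ℝ → ℝ) (u : E N → ℝ → ℝ) (x₀ : E N)
    (r R : ℝ) (J : Set ℝ) (ψ : E N → ℝ) (l α M δ Cψ : ℝ) : Prop where
  hN : 2 ≤ N
  hs0 : 0 < s
  hs1 : s < 1
  hΛ : 1 ≤ Λ
  hK : KernelOK N s Λ T K
  hum : Measurable (fun p : E N × ℝ => u p.1 p.2)
  hM : ∀ x t, t ∈ Ioo 0 T → |u x t| ≤ M
  hrR : r < R
  hJT : J ⊆ Ioo 0 T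
  hJm : MeasurableSet J
  hpos : ∀ x ∈ ball x₀ R, ∀ t ∈ J, 0 ≤ u x t
  hl : 0 < l
  h0 : 0 < α
  h1 : α < 1
  hψ : ContDiff ℝ (⊤ : ℕ∞) ψ
  hψc : HasCompactSupport ψ
  hψA : tsupport ψ ⊆ ball x₀ r
  hδ0 : 0 < δ
  hδ1 : δ ≤ 1
  hδ : ∀ x ∈ tsupport ψ, ∀ y, y ∉ ball x₀ r → δ ≤ ‖x - y‖
  hCψ0 : 0 ≤ Cψ
  hCψ : ∀ x y, (ψ x - ψ y) ^ 2 ≤ Cψ * min 1 (‖x - y‖ ^ 2)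
  hψM : ∀ x, ψ x ^ 2 ≤ Cψ

lemma exists_delta {N : ℕ} {ψ : E N → ℝ} {x₀ : E N} {r : ℝ} (hψc : HasCompactSupport ψ)
    (hψA : tsupport ψ ⊆ ball x₀ r) :
    ∃ δ : ℝ, 0 < δ ∧ δ ≤ 1 ∧ ∀ x ∈ tsupport ψ, ∀ y, y ∉ ball x₀ r → δ ≤ ‖x - y‖ := by
  obtain ⟨δ, hδ, h⟩ := IsCompact.exists_thickening_subset_open hψc isOpen_ball hψA
  refine ⟨min δ 1, lt_min hδ one_pos, min_le_right _ _, ?_⟩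
  intro x hx y hy
  by_contra hc
  push Not at hc
  apply hy
  apply h
  rw [mem_thickening_iff]
  refine ⟨x, hx, ?_⟩
  rw [dist_comm, dist_eq_norm]
  exact lt_of_lt_of_le hc (min_le_left _ _)

lemma exists_Cψ {N : ℕ} {ψ : E N → ℝ} (hψ : ContDiff ℝ (⊤ : ℕ∞) ψ) (hψc : HasCompactSupport ψ) :
    ∃ C : ℝ, 0 ≤ C ∧ (∀ x y, (ψ x - ψ y) ^ 2 ≤ C * min 1 (‖x - y‖ ^ 2)) ∧ ∀ x, ψ x ^ 2 ≤ C := by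
  obtain ⟨L, hL⟩ := ContDiff.lipschitzWith_of_hasCompactSupport hψc hψ (by simp)
  obtain ⟨m, hm⟩ := hψc.exists_bound_of_continuous hψ.continuous
  have hm0 : 0 ≤ m := (norm_nonneg _).trans (hm 0)
  have hb : ∀ x, |ψ x| ≤ m := fun x => hm x
  refine ⟨(L : ℝ) ^ 2 + 4 * m ^ 2, by positivity, ?_, ?_⟩
  · intro x y
    have h1 : |ψ x - ψ y| ≤ L * ‖x - y‖ := by
      have := hL.dist_le_mul x y
      rwa [dist_eq_norm, dist_eq_norm] at this
    have h2 : |ψ x - ψ y| ≤ 2 * m := by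
      calc |ψ x - ψ y| ≤ |ψ x| + |ψ y| := abs_sub _ _
        _ ≤ 2 * m := by linarith [hb x, hb y]
    rw [← sq_abs (ψ x - ψ y)]
    have h3 := pow_le_pow_left₀ (abs_nonneg _) h1 2
    have h4 := pow_le_pow_left₀ (abs_nonneg _) h2 2
    rcases le_total 1 (‖x - y‖ ^ 2) with h | h
    · rw [min_eq_left h]; nlinarith [sq_nonneg (L : ℝ)]
    · rw [min_eq_right h]; nlinarith [mul_nonneg (sq_nonneg m) (sq_nonneg ‖x - y‖)]
  · intro x
    have := pow_le_pow_left₀ (abs_nonneg _) (hb x) 2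
    rw [sq_abs] at this
    nlinarith [sq_nonneg (L : ℝ), sq_nonneg m]

namespace Glob
variable {N : ℕ} {s Λ T : ℝ} {K : E N → E N → ℝ → ℝ} {u : E N → ℝ → ℝ} {x₀ : E N}
    {r R : ℝ} {J : Set ℝ} {ψ : E N → ℝ} {l α M δ Cψ : ℝ}

lemma K_nonneg (G : Glob N s Λ T K u x₀ r R J ψ l α M δ Cψ) {x y : E N} (h : x ≠ y) {t : ℝ}
    (ht : t ∈ Ioo 0 T) : 0 ≤ K x y t := by
  refine le_trans ?_ (G.hK.2.2 x y h t ht).1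
  have := G.hΛ
  positivity

lemma ker_bd (G : Glob N s Λ T K u x₀ r R J ψ l α M δ Cψ) {x y : E N} {t c C : ℝ}
    (ht : t ∈ Ioo 0 T) (hc : |c| ≤ C * min 1 (‖x - y‖ ^ 2)) :
    |c * K x y t| ≤ C * Λ * kap N s (x - y) := by
  by_cases h : x = y
  · subst h
    have hc0 : c = 0 := by simpa using hc
    simp [hc0, kap]
  · rw [abs_mul, abs_of_nonneg (G.K_nonneg h ht)]
    calc |c| * K x y t ≤ (C * min 1 (‖x - y‖ ^ 2)) * (Λ * ‖x - y‖ ^ (-((N : ℝ) + 2 * s))) :=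
          mul_le_mul hc (G.hK.2.2 x y h t ht).2 (G.K_nonneg h ht) ((abs_nonneg _).trans hc)
      _ = _ := by unfold kap; ring

lemma k_far (G : Glob N s Λ T K u x₀ r R J ψ l α M δ Cψ) {x y : E N}
    (h : δ ≤ ‖x - y‖) : ‖x - y‖ ^ (-((N : ℝ) + 2 * s)) ≤ δ⁻¹ ^ 2 * kap N s (x - y) := by
  unfold kap
  have hδ := G.hδ0
  have h1 : 1 ≤ δ⁻¹ ^ 2 * min 1 (‖x - y‖ ^ 2) := by
    rw [inv_pow, ← div_eq_inv_mul, le_div_iff₀ (by positivity), one_mul, le_min_iff]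
    exact ⟨by nlinarith [G.hδ1], by nlinarith⟩
  rw [← mul_assoc]
  exact le_mul_of_one_le_left (by positivity) h1

lemma hAB (G : Glob N s Λ T K u x₀ r R J ψ l α M δ Cψ) : ball x₀ r ⊆ ball x₀ R :=
  ball_subset_ball G.hrR.le

lemma vbd (G : Glob N s Λ T K u x₀ r R J ψ l α M δ Cψ) {x : E N} (hx : x ∈ ball x₀ R) {t : ℝ}
    (ht : t ∈ J) : 0 ≤ (u x t + l) ^ α ∧ (u x t + l) ^ α ≤ (M + l) ^ α := by
  have h1 := G.hpos x hx t ht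
  have h2 := (abs_le.1 (G.hM x t (G.hJT ht))).2
  have h3 := G.hl
  exact ⟨Real.rpow_nonneg (by linarith) _, Real.rpow_le_rpow (by linarith) (by linarith) G.h0.le⟩

lemma kk_int (G : Glob N s Λ T K u x₀ r R J ψ l α M δ Cψ) : Integrable (kk N s (ball x₀ r)) :=
  kk_integrable N G.hN s G.hs0 G.hs1 measurableSet_ball measure_ball_lt_top.ne

lemma kap_int (G : Glob N s Λ T K u x₀ r R J ψ l α M δ Cψ) (x : E N) :
    Integrable (fun y => kap N s (x - y)) :=
  (kap_integrable N G.hN s G.hs0 G.hs1).comp_sub_left x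

lemma um_meas (G : Glob N s Λ T K u x₀ r R J ψ l α M δ Cψ) (t : ℝ) :
    Measurable (fun x => u x t) := G.hum.comp (measurable_id.prodMk measurable_const)

lemma k_meas (x : E N) : Measurable (fun y : E N => ‖x - y‖ ^ (-((N : ℝ) + 2 * s))) :=
  (measurable_const.sub measurable_id).norm.pow_const _

lemma k_int (G : Glob N s Λ T K u x₀ r R J ψ l α M δ Cψ) {x : E N} (hx : x ∈ tsupport ψ) :
    IntegrableOn (fun y => ‖x - y‖ ^ (-((N : ℝ) + 2 * s))) (ball x₀ r)ᶜ := by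
  refine Integrable.mono' ((G.kap_int x).const_mul (δ⁻¹ ^ 2)).integrableOn
    (k_meas x).aestronglyMeasurable ?_
  refine (ae_restrict_iff' measurableSet_ball.compl).2 (Filter.Eventually.of_forall ?_)
  intro y hy
  rw [Real.norm_of_nonneg (by positivity)]
  exact G.k_far (G.hδ x hx y hy)

lemma um_le (G : Glob N s Λ T K u x₀ r R J ψ l α M δ Cψ) {t : ℝ} (ht : t ∈ J) (y : E N) :
    0 ≤ uminus N u y t ∧ uminus N u y t ≤ M := by
  have h2 := abs_le.1 (G.hM y t (G.hJT ht))
  exact ⟨le_max_right _ _, max_le (by linarith) (by linarith)⟩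

lemma uk_int (G : Glob N s Λ T K u x₀ r R J ψ l α M δ Cψ) {x : E N} (hx : x ∈ tsupport ψ)
    {t : ℝ} (ht : t ∈ J) :
    IntegrableOn (fun y => uminus N u y t * ‖x - y‖ ^ (-((N : ℝ) + 2 * s))) (ball x₀ R)ᶜ := by
  have h1 := (G.k_int hx).mono_set (compl_subset_compl.2 G.hAB)
  refine Integrable.mono' (h1.const_mul M) ?_ ?_
  · exact (((G.um_meas t).neg.max measurable_const).mul (k_meas x)).aestronglyMeasurable
  · refine Filter.Eventually.of_forall ?_
    intro y
    have := G.um_le ht y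
    rw [Real.norm_of_nonneg (mul_nonneg this.1 (by positivity))]
    exact mul_le_mul_of_nonneg_right this.2 (by positivity)

lemma I1_bd (G : Glob N s Λ T K u x₀ r R J ψ l α M δ Cψ) {x : E N} (hx : x ∈ tsupport ψ) :
    ∫ y in (ball x₀ r)ᶜ, ‖x - y‖ ^ (-((N : ℝ) + 2 * s)) ≤ δ⁻¹ ^ 2 * ∫ y, kap N s y := by
  calc ∫ y in (ball x₀ r)ᶜ, ‖x - y‖ ^ (-((N : ℝ) + 2 * s))
      ≤ ∫ y in (ball x₀ r)ᶜ, δ⁻¹ ^ 2 * kap N s (x - y) := by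
        apply setIntegral_mono_on (G.k_int hx) ((G.kap_int x).const_mul _).integrableOn
          measurableSet_ball.compl
        intro y hy
        exact G.k_far (G.hδ x hx y hy)
    _ ≤ ∫ y, δ⁻¹ ^ 2 * kap N s (x - y) := by
        apply setIntegral_le_integral ((G.kap_int x).const_mul _)
        refine Filter.Eventually.of_forall (fun y => ?_)
        exact mul_nonneg (by positivity) (kap_nonneg _ _ _)
    _ = _ := by
        rw [integral_const_mul, integral_sub_left_eq_self (kap N s) volume x]

lemma I2_bd (G : Glob N s Λ T K u x₀ r R J ψ l α M δ Cψ) {x : E N} (hx : x ∈ tsupport ψ)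
    {t : ℝ} (ht : t ∈ J) :
    ∫ y in (ball x₀ R)ᶜ, uminus N u y t * ‖x - y‖ ^ (-((N : ℝ) + 2 * s)) ≤
      M * (δ⁻¹ ^ 2 * ∫ y, kap N s y) := by
  have hM0 : 0 ≤ M := (G.um_le ht x).1.trans (G.um_le ht x).2
  have h1 := (G.k_int hx).mono_set (compl_subset_compl.2 G.hAB)
  calc _ ≤ ∫ y in (ball x₀ R)ᶜ, M * ‖x - y‖ ^ (-((N : ℝ) + 2 * s)) := by
        apply setIntegral_mono_on (G.uk_int hx ht) (h1.const_mul _) measurableSet_ball.compl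
        intro y hy
        exact mul_le_mul_of_nonneg_right (G.um_le ht y).2 (by positivity)
    _ = M * ∫ y in (ball x₀ R)ᶜ, ‖x - y‖ ^ (-((N : ℝ) + 2 * s)) := by rw [integral_const_mul]
    _ ≤ M * ∫ y in (ball x₀ r)ᶜ, ‖x - y‖ ^ (-((N : ℝ) + 2 * s)) := by
        apply mul_le_mul_of_nonneg_left _ hM0
        apply setIntegral_mono_set (G.k_int hx)
        · exact Filter.Eventually.of_forall (fun y => by simp only [Pi.zero_apply]; positivity)
        · exact (compl_subset_compl.2 G.hAB).eventuallyLE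
    _ ≤ _ := mul_le_mul_of_nonneg_left (G.I1_bd hx) hM0

end Glob

/-- first supremum -/
def sup1 (N : ℕ) (s : ℝ) (x₀ : E N) (r : ℝ) (ψ : E N → ℝ) : ℝ :=
  ⨆ x ∈ tsupport ψ, ∫ y in (Metric.ball x₀ r)ᶜ, ‖x - y‖ ^ (-((N : ℝ) + 2 * s))

/-- second supremum -/
def sup2 (N : ℕ) (s : ℝ) (u : E N → ℝ → ℝ) (x₀ : E N) (R : ℝ) (ψ : E N → ℝ) (t : ℝ) : ℝ :=
  ⨆ x ∈ tsupport ψ, ∫ y in (Metric.ball x₀ R)ᶜ,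
    uminus N u y t * ‖x - y‖ ^ (-((N : ℝ) + 2 * s))

/-- nonlocal integrand -/
def nlF {N : ℕ} (K : E N → E N → ℝ → ℝ) (u : E N → ℝ → ℝ) (l α : ℝ) (ψ : E N → ℝ) (χ : ℝ → ℝ)
    (t : ℝ) (q : E N × E N) : ℝ :=
  (u q.1 t - u q.2 t) * (tst u l α ψ χ q.1 t - tst u l α ψ χ q.2 t) * K q.1 q.2 t

lemma slice_fd {N : ℕ} {u : E N → ℝ → ℝ} {U : Set (E N × ℝ)} (hU : IsOpen U)
    (hu : ContDiffOn ℝ (⊤ : ℕ∞) (fun p : E N × ℝ => u p.1 p.2) U) {z : E N} {t : ℝ}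
    (hz : (z, t) ∈ U) : HasFDerivAt (fun y => u y t)
        ((fderiv ℝ (fun p : E N × ℝ => u p.1 p.2) (z, t)).comp
          (ContinuousLinearMap.inl ℝ (E N) ℝ)) z := by
  have h0 : ContDiffAt ℝ (⊤ : ℕ∞) (fun p : E N × ℝ => u p.1 p.2) (z, t) :=
    hu.contDiffAt (hU.mem_nhds hz)
  have h1 : DifferentiableAt ℝ (fun p : E N × ℝ => u p.1 p.2) (z, t) :=
    h0.differentiableAt (by simp)
  exact HasFDerivAt.comp (g := fun p : E N × ℝ => u p.1 p.2) (f := fun y : E N => (y, t)) z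
    h1.hasFDerivAt (hasFDerivAt_prodMk_left z t)

namespace Glob
variable {N : ℕ} {s Λ T : ℝ} {K : E N → E N → ℝ → ℝ} {u : E N → ℝ → ℝ} {x₀ : E N}
    {r R : ℝ} {J : Set ℝ} {ψ : E N → ℝ} {l α M δ Cψ : ℝ} {χ : ℝ → ℝ}

lemma nl_bound (G : Glob N s Λ T K u x₀ r R J ψ l α M δ Cψ)
    (L : Loc N u l α ψ χ (ball x₀ R) J) :
    ∃ C : ℝ, 0 ≤ C ∧ ∀ t x y, |(u x t - u y t) * (tst u l α ψ χ x t - tst u l α ψ χ y t)| ≤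
      C * min 1 (‖x - y‖ ^ 2) := by
  obtain ⟨Lφ, hL⟩ := ContDiff.lipschitzWith_of_hasCompactSupport L.tst_cpt L.tst_smooth (by simp)
  obtain ⟨m, hm⟩ := L.tst_cpt.exists_bound_of_continuous L.tst_smooth.continuous
  have hm0 : 0 ≤ m := (norm_nonneg _).trans (hm (0, 0))
  have hcpt : IsCompact (closedBall x₀ r ×ˢ tsupport χ) :=
    (isCompact_closedBall x₀ r).prod L.hχc
  have hsub : closedBall x₀ r ×ˢ tsupport χ ⊆ ball x₀ R ×ˢ J :=
    prod_mono (closedBall_subset_ball G.hrR) L.hχJ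
  obtain ⟨Cu, hCu⟩ := hcpt.exists_bound_of_continuousOn
    ((L.hu.continuousOn_fderiv_of_isOpen L.isOpen (by simp)).mono hsub)
  have hlip : ∀ t ∈ tsupport χ, ∀ x ∈ ball x₀ r, ∀ y ∈ ball x₀ r,
      |u x t - u y t| ≤ Cu * ‖x - y‖ := by
    intro t ht x hx y hy
    have hd : ∀ z ∈ ball x₀ r, HasFDerivAt (fun y => u y t)
        ((fderiv ℝ (fun p : E N × ℝ => u p.1 p.2) (z, t)).comp
          (ContinuousLinearMap.inl ℝ (E N) ℝ)) z := by
      intro z hz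
      exact slice_fd L.isOpen L.hu
        (mk_mem_prod (closedBall_subset_ball G.hrR (ball_subset_closedBall hz)) (L.hχJ ht))
    have := Convex.norm_image_sub_le_of_norm_fderiv_le (𝕜 := ℝ) (f := fun y => u y t) (C := Cu)
      (s := ball x₀ r) (x := y) (y := x) (fun z hz => (hd z hz).differentiableAt) ?_
      (convex_ball x₀ r) hy hx
    · exact this
    · intro z hz
      rw [(hd z hz).fderiv]
      refine (ContinuousLinearMap.opNorm_comp_le _ _).trans ?_
      have h2 := hCu (z, t) ⟨ball_subset_closedBall hz, ht⟩
      have h3 := ContinuousLinearMap.norm_inl_le_one ℝ (E N) ℝ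
      calc _ ≤ ‖fderiv ℝ (fun p : E N × ℝ => u p.1 p.2) (z, t)‖ * 1 :=
            mul_le_mul_of_nonneg_left h3 (norm_nonneg _)
        _ ≤ Cu := by rw [mul_one]; exact h2
  have hδ := G.hδ0
  refine ⟨4 * |M| * m * δ⁻¹ ^ 2 + |Cu| * Lφ, by positivity, ?_⟩
  intro t x y
  have hmin : 0 ≤ min 1 (‖x - y‖ ^ 2) := by positivity
  by_cases ht : t ∈ tsupport χ
  swap
  · have : χ t = 0 := image_eq_zero_of_notMem_tsupport ht
    simp only [tst, this, mul_zero, sub_zero, abs_zero]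
    positivity
  have htT := G.hJT (L.hχJ ht)
  rw [abs_mul]
  by_cases hxy : δ ≤ ‖x - y‖
  · have h1 : 1 ≤ δ⁻¹ ^ 2 * min 1 (‖x - y‖ ^ 2) := by
      rw [inv_pow, ← div_eq_inv_mul, le_div_iff₀ (by positivity), one_mul, le_min_iff]
      exact ⟨by nlinarith [G.hδ1], by nlinarith⟩
    have h2 : |u x t - u y t| ≤ 2 * |M| := by
      have a1 := G.hM x t htT
      have a2 := G.hM y t htT
      have a3 := abs_sub (u x t) (u y t)
      have a4 := le_abs_self M
      linarith
    have h3 : |tst u l α ψ χ x t - tst u l α ψ χ y t| ≤ 2 * m := by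
      have a1 := hm (x, t)
      have a2 := hm (y, t)
      have a3 := abs_sub (tst u l α ψ χ x t) (tst u l α ψ χ y t)
      simp only [Real.norm_eq_abs] at a1 a2
      linarith
    calc _ ≤ 2 * |M| * (2 * m) := mul_le_mul h2 h3 (abs_nonneg _) (by positivity)
      _ = 4 * |M| * m * 1 := by ring
      _ ≤ 4 * |M| * m * (δ⁻¹ ^ 2 * min 1 (‖x - y‖ ^ 2)) :=
          mul_le_mul_of_nonneg_left h1 (by positivity)
      _ ≤ _ := by
          have : 0 ≤ |Cu| * Lφ * min 1 (‖x - y‖ ^ 2) := by positivity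
          linarith
  · push Not at hxy
    have hx1 : ‖x - y‖ < 1 := hxy.trans_le G.hδ1
    have hmn : min 1 (‖x - y‖ ^ 2) = ‖x - y‖ ^ 2 :=
      min_eq_right (by nlinarith [norm_nonneg (x - y)])
    rw [hmn]
    by_cases hin : x ∈ tsupport ψ ∨ y ∈ tsupport ψ
    · have hxyA : x ∈ ball x₀ r ∧ y ∈ ball x₀ r := by
        rcases hin with h | h
        · refine ⟨G.hψA h, ?_⟩
          by_contra hc
          exact absurd (G.hδ x h y hc) (not_le.2 hxy)
        · refine ⟨?_, G.hψA h⟩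
          by_contra hc
          have := G.hδ y h x hc
          rw [norm_sub_rev] at this
          exact absurd this (not_le.2 hxy)
      have h1 : |u x t - u y t| ≤ |Cu| * ‖x - y‖ :=
        (hlip t ht x hxyA.1 y hxyA.2).trans
          (mul_le_mul_of_nonneg_right (le_abs_self _) (norm_nonneg _))
      have h2 : |tst u l α ψ χ x t - tst u l α ψ χ y t| ≤ Lφ * ‖x - y‖ := by
        have := hL.dist_le_mul (x, t) (y, t)
        simpa [Prod.dist_eq, dist_eq_norm] using this
      calc _ ≤ |Cu| * ‖x - y‖ * (Lφ * ‖x - y‖) :=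
            mul_le_mul h1 h2 (abs_nonneg _) (by positivity)
        _ = |Cu| * Lφ * ‖x - y‖ ^ 2 := by ring
        _ ≤ _ := by
          have : 0 ≤ 4 * |M| * m * δ⁻¹ ^ 2 * ‖x - y‖ ^ 2 := by positivity
          linarith
    · push Not at hin
      have e1 : ψ x = 0 := image_eq_zero_of_notMem_tsupport hin.1
      have e2 : ψ y = 0 := image_eq_zero_of_notMem_tsupport hin.2
      simp only [tst, e1, e2]
      simp
      positivity

lemma nl_bd (G : Glob N s Λ T K u x₀ r R J ψ l α M δ Cψ)
    (L : Loc N u l α ψ χ (ball x₀ R) J) :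
    ∃ C : ℝ, 0 ≤ C ∧ ∀ t q, |nlF K u l α ψ χ t q| ≤
      (tsupport χ).indicator (fun _ => C) t * kk N s (ball x₀ r) q := by
  obtain ⟨C, hC0, hC⟩ := G.nl_bound L
  have hΛ := G.hΛ
  refine ⟨C * Λ, by positivity, ?_⟩
  rintro t ⟨x, y⟩
  have hk := kk_nonneg N s (ball x₀ r) (x, y)
  by_cases ht : t ∈ tsupport χ
  swap
  · have : χ t = 0 := image_eq_zero_of_notMem_tsupport ht
    simp [nlF, tst, this, indicator_of_notMem ht]
  rw [indicator_of_mem ht]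
  have h1 := G.ker_bd (G.hJT (L.hχJ ht)) (hC t x y)
  by_cases hx : x ∈ ball x₀ r
  · exact h1.trans (mul_le_mul_of_nonneg_left (kap_le_kk_left hx) (by positivity))
  by_cases hy : y ∈ ball x₀ r
  · exact h1.trans (mul_le_mul_of_nonneg_left (kap_le_kk_right hy) (by positivity))
  · have e1 : ψ x = 0 := image_eq_zero_of_notMem_tsupport (fun h => hx (G.hψA h))
    have e2 : ψ y = 0 := image_eq_zero_of_notMem_tsupport (fun h => hy (G.hψA h))
    simp only [nlF, tst, e1, e2]
    simp
    positivity

lemma nl_meas (G : Glob N s Λ T K u x₀ r R J ψ l α M δ Cψ)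
    (L : Loc N u l α ψ χ (ball x₀ R) J) :
    Measurable (fun p : ℝ × (E N × E N) => nlF K u l α ψ χ p.1 p.2) := by
  have hu1 : Measurable (fun p : ℝ × (E N × E N) => u p.2.1 p.1) :=
    G.hum.comp (measurable_snd.fst.prodMk measurable_fst)
  have hu2 : Measurable (fun p : ℝ × (E N × E N) => u p.2.2 p.1) :=
    G.hum.comp (measurable_snd.snd.prodMk measurable_fst)
  have hφ := L.tst_smooth.continuous.measurable
  have hp1 : Measurable (fun p : ℝ × (E N × E N) => tst u l α ψ χ p.2.1 p.1) :=
    hφ.comp (measurable_snd.fst.prodMk measurable_fst)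
  have hp2 : Measurable (fun p : ℝ × (E N × E N) => tst u l α ψ χ p.2.2 p.1) :=
    hφ.comp (measurable_snd.snd.prodMk measurable_fst)
  have hk : Measurable (fun p : ℝ × (E N × E N) => K p.2.1 p.2.2 p.1) :=
    G.hK.1.comp (measurable_snd.fst.prodMk (measurable_snd.snd.prodMk measurable_fst))
  exact ((hu1.sub hu2).mul (hp1.sub hp2)).mul hk

lemma nl_int3 (G : Glob N s Λ T K u x₀ r R J ψ l α M δ Cψ)
    (L : Loc N u l α ψ χ (ball x₀ R) J) :
    Integrable (fun p : ℝ × (E N × E N) => nlF K u l α ψ χ p.1 p.2) := by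
  obtain ⟨C, hC0, hC⟩ := G.nl_bd L
  have hi : Integrable ((tsupport χ).indicator (fun _ => C)) :=
    (integrable_indicator_iff (isClosed_tsupport χ).measurableSet).2
      (integrableOn_const L.hχc.measure_lt_top.ne)
  refine Integrable.mono' (hi.mul_prod G.kk_int) (G.nl_meas L).aestronglyMeasurable ?_
  exact Filter.Eventually.of_forall (fun p => hC p.1 p.2)

lemma nl_int2 (G : Glob N s Λ T K u x₀ r R J ψ l α M δ Cψ)
    (L : Loc N u l α ψ χ (ball x₀ R) J) (t : ℝ) :
    Integrable (fun q : E N × E N => nlF K u l α ψ χ t q) := by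
  obtain ⟨C, hC0, hC⟩ := G.nl_bd L
  refine Integrable.mono' (G.kk_int.const_mul ((tsupport χ).indicator (fun _ => C) t))
    ((G.nl_meas L).comp (measurable_const.prodMk measurable_id)).aestronglyMeasurable ?_
  exact Filter.Eventually.of_forall (fun p => hC t p)

lemma nl_iter (G : Glob N s Λ T K u x₀ r R J ψ l α M δ Cψ)
    (L : Loc N u l α ψ χ (ball x₀ R) J) (t : ℝ) :
    (∫ x, ∫ y, nlF K u l α ψ χ t (x, y)) = ∫ q, nlF K u l α ψ χ t q :=
  (integral_prod _ (G.nl_int2 L t)).symm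

lemma nl_int1 (G : Glob N s Λ T K u x₀ r R J ψ l α M δ Cψ)
    (L : Loc N u l α ψ χ (ball x₀ R) J) :
    Integrable (fun t => ∫ x, ∫ y, nlF K u l α ψ χ t (x, y)) := by
  simp_rw [G.nl_iter L]
  exact (G.nl_int3 L).integral_prod_left

lemma nl_restrict (G : Glob N s Λ T K u x₀ r R J ψ l α M δ Cψ)
    (L : Loc N u l α ψ χ (ball x₀ R) J) :
    ∫ t in Ioo 0 T, ∫ x, ∫ y, nlF K u l α ψ χ t (x, y) =
      ∫ t in J, ∫ x, ∫ y, nlF K u l α ψ χ t (x, y) := by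
  have h0 : ∀ t, t ∉ J → ∫ x, ∫ y, nlF K u l α ψ χ t (x, y) = 0 := by
    intro t ht
    have : χ t = 0 := image_eq_zero_of_notMem_tsupport (fun h => ht (L.hχJ h))
    simp [nlF, tst, this]
  rw [setIntegral_eq_integral_of_forall_compl_eq_zero h0,
    setIntegral_eq_integral_of_forall_compl_eq_zero (fun t ht => h0 t (fun h => ht (G.hJT h)))]

end Glob

/-- local part of the nonlocal integrand -/
def h1F {N : ℕ} (K : E N → E N → ℝ → ℝ) (u : E N → ℝ → ℝ) (l α : ℝ) (ψ : E N → ℝ) (χ : ℝ → ℝ)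
    (t : ℝ) (q : E N × E N) : ℝ :=
  (ψ q.1 - ψ q.2) ^ 2 * ((u q.1 t + l) ^ α + (u q.2 t + l) ^ α) * χ t * K q.1 q.2 t

/-- far part of the nonlocal integrand -/
def h2F {N : ℕ} (s Λ : ℝ) (u : E N → ℝ → ℝ) (l α : ℝ) (ψ : E N → ℝ) (χ : ℝ → ℝ) (B : Set (E N))
    (t : ℝ) (q : E N × E N) : ℝ :=
  ((u q.1 t + l) ^ α * ψ q.1 ^ 2 * χ t) *
    (Λ * ((1 + l⁻¹ * Bᶜ.indicator (fun y => uminus N u y t) q.2) *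
      ‖q.1 - q.2‖ ^ (-((N : ℝ) + 2 * s))))

namespace Glob
variable {N : ℕ} {s Λ T : ℝ} {K : E N → E N → ℝ → ℝ} {u : E N → ℝ → ℝ} {x₀ : E N}
    {r R : ℝ} {J : Set ℝ} {ψ : E N → ℝ} {l α M δ Cψ : ℝ} {χ : ℝ → ℝ}

lemma M_nonneg (G : Glob N s Λ T K u x₀ r R J ψ l α M δ Cψ) {t : ℝ} (ht : t ∈ J) : 0 ≤ M :=
  (G.um_le ht x₀).1.trans (G.um_le ht x₀).2

lemma h1_bd (G : Glob N s Λ T K u x₀ r R J ψ l α M δ Cψ) {t : ℝ} (ht : t ∈ J)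
    {q : E N × E N} (hq : q ∈ ball x₀ r ×ˢ ball x₀ r) :
    |h1F K u l α ψ χ t q| ≤ |χ t| * (Cψ * (2 * (M + l) ^ α) * Λ * kk N s (ball x₀ r) q) := by
  obtain ⟨x, y⟩ := q
  have v1 := G.vbd (G.hAB hq.1) ht
  have v2 := G.vbd (G.hAB hq.2) ht
  have hC := G.hCψ0
  have hΛ := G.hΛ
  have hb : |(ψ x - ψ y) ^ 2 * ((u x t + l) ^ α + (u y t + l) ^ α) * χ t| ≤
      (Cψ * (2 * (M + l) ^ α) * |χ t|) * min 1 (‖x - y‖ ^ 2) := by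
    rw [abs_mul, abs_of_nonneg (mul_nonneg (sq_nonneg _) (add_nonneg v1.1 v2.1))]
    calc _ ≤ (Cψ * min 1 (‖x - y‖ ^ 2)) * (2 * (M + l) ^ α) * |χ t| := by
          apply mul_le_mul_of_nonneg_right _ (abs_nonneg _)
          exact mul_le_mul (G.hCψ x y) (by linarith [v1.2, v2.2]) (add_nonneg v1.1 v2.1)
            (by positivity)
      _ = _ := by ring
  have h := G.ker_bd (G.hJT ht) hb
  refine h.trans ?_
  have h2 : kap N s (x - y) ≤ kk N s (ball x₀ r) (x, y) := kap_le_kk_left hq.1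
  have h3 : 0 ≤ Cψ * (2 * (M + l) ^ α) * |χ t| * Λ := by
    have := v1.1.trans v1.2
    positivity
  calc _ ≤ _ := mul_le_mul_of_nonneg_left h2 h3
    _ = _ := by ring

lemma h1_meas (G : Glob N s Λ T K u x₀ r R J ψ l α M δ Cψ) (hχ : Measurable χ) :
    Measurable (fun p : ℝ × (E N × E N) => h1F K u l α ψ χ p.1 p.2) := by
  have hu1 : Measurable (fun p : ℝ × (E N × E N) => u p.2.1 p.1) :=
    G.hum.comp (measurable_snd.fst.prodMk measurable_fst)
  have hu2 : Measurable (fun p : ℝ × (E N × E N) => u p.2.2 p.1) :=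
    G.hum.comp (measurable_snd.snd.prodMk measurable_fst)
  have hφ := G.hψ.continuous.measurable
  have hp1 : Measurable (fun p : ℝ × (E N × E N) => ψ p.2.1) := hφ.comp measurable_snd.fst
  have hp2 : Measurable (fun p : ℝ × (E N × E N) => ψ p.2.2) := hφ.comp measurable_snd.snd
  have hk : Measurable (fun p : ℝ × (E N × E N) => K p.2.1 p.2.2 p.1) :=
    G.hK.1.comp (measurable_snd.fst.prodMk (measurable_snd.snd.prodMk measurable_fst))
  exact ((((hp1.sub hp2).pow_const 2).mul (((hu1.add_const l).pow_const α).add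
    ((hu2.add_const l).pow_const α))).mul (hχ.comp measurable_fst)).mul hk

lemma h1_int2 (G : Glob N s Λ T K u x₀ r R J ψ l α M δ Cψ) (hχ : Measurable χ) {t : ℝ}
    (ht : t ∈ J) :
    IntegrableOn (fun q : E N × E N => h1F K u l α ψ χ t q) (ball x₀ r ×ˢ ball x₀ r) := by
  refine Integrable.mono' ((G.kk_int.const_mul (Cψ * (2 * (M + l) ^ α) * Λ)).const_mul
    |χ t|).integrableOn
    ((G.h1_meas hχ).comp (measurable_const.prodMk measurable_id)).aestronglyMeasurable ?_
  refine (ae_restrict_iff' (measurableSet_ball.prod measurableSet_ball)).2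
    (Filter.Eventually.of_forall ?_)
  intro q hq
  exact G.h1_bd ht hq

lemma h1_iter (G : Glob N s Λ T K u x₀ r R J ψ l α M δ Cψ) (hχ : Measurable χ) {t : ℝ}
    (ht : t ∈ J) :
    ∫ x in ball x₀ r, ∫ y in ball x₀ r, h1F K u l α ψ χ t (x, y) =
      ∫ q in ball x₀ r ×ˢ ball x₀ r, h1F K u l α ψ χ t q :=
  (setIntegral_prod _ (G.h1_int2 hχ ht)).symm

lemma h1_int1 (G : Glob N s Λ T K u x₀ r R J ψ l α M δ Cψ) (hχ : Measurable χ) {m : ℝ}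
    (hm : ∀ t ∈ J, |χ t| ≤ m) (hJf : volume J ≠ ⊤) :
    IntegrableOn (fun t => ∫ x in ball x₀ r, ∫ y in ball x₀ r, h1F K u l α ψ χ t (x, y)) J := by
  have h3 : IntegrableOn (fun p : ℝ × (E N × E N) => h1F K u l α ψ χ p.1 p.2)
      (J ×ˢ (ball x₀ r ×ˢ ball x₀ r)) := by
    have hi : Integrable (J.indicator (fun _ => m)) :=
      (integrable_indicator_iff G.hJm).2 (integrableOn_const hJf)
    refine Integrable.mono' ((hi.mul_prod (G.kk_int.const_mul
      (Cψ * (2 * (M + l) ^ α) * Λ))).integrableOn) (G.h1_meas hχ).aestronglyMeasurable ?_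
    refine (ae_restrict_iff' (G.hJm.prod (measurableSet_ball.prod measurableSet_ball))).2
      (Filter.Eventually.of_forall ?_)
    rintro ⟨t, q⟩ ⟨ht, hq⟩
    have ht' : t ∈ J := ht
    have h := G.h1_bd (χ := χ) ht' hq
    simp only [indicator_of_mem ht']
    refine h.trans (mul_le_mul_of_nonneg_right (hm t ht') ?_)
    have := kk_nonneg N s (ball x₀ r) q
    have := G.hCψ0
    have := G.hΛ
    have := G.M_nonneg ht'
    have := G.hl
    positivity
  unfold IntegrableOn at h3
  rw [Measure.volume_eq_prod, ← Measure.prod_restrict] at h3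
  have h4 := h3.integral_prod_left
  refine h4.congr ?_
  refine (ae_restrict_iff' G.hJm).2 (Filter.Eventually.of_forall ?_)
  intro t ht
  exact (G.h1_iter hχ ht).symm

lemma h1_nonneg (G : Glob N s Λ T K u x₀ r R J ψ l α M δ Cψ) {t : ℝ} (ht : t ∈ J)
    (hχ : 0 ≤ χ t) {x y : E N} (hx : x ∈ ball x₀ r) (hy : y ∈ ball x₀ r) :
    0 ≤ h1F K u l α ψ χ t (x, y) := by
  have v1 := G.vbd (G.hAB hx) ht
  have v2 := G.vbd (G.hAB hy) ht
  unfold h1F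
  by_cases h : x = y
  · subst h; simp
  · exact mul_nonneg (mul_nonneg (mul_nonneg (sq_nonneg _) (add_nonneg v1.1 v2.1)) hχ)
      (G.K_nonneg h (G.hJT ht))

/-- weighted spatial integrals -/
lemma V_bd (G : Glob N s Λ T K u x₀ r R J ψ l α M δ Cψ) {t : ℝ} (ht : t ∈ J) {f : E N → ℝ}
    {m : ℝ} (hf : ∀ x, 0 ≤ f x ∧ f x ≤ m) {x : E N} (hx : x ∈ ball x₀ r) :
    |(u x t + l) ^ α * f x * χ t| ≤ |χ t| * ((M + l) ^ α * m) := by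
  have v1 := G.vbd (G.hAB hx) ht
  rw [abs_mul, abs_of_nonneg (mul_nonneg v1.1 (hf x).1), mul_comm]
  exact mul_le_mul_of_nonneg_left (mul_le_mul v1.2 (hf x).2 (hf x).1 (v1.1.trans v1.2))
    (abs_nonneg _)

lemma V_meas (G : Glob N s Λ T K u x₀ r R J ψ l α M δ Cψ) {f : E N → ℝ} (hfm : Measurable f)
    (hχ : Measurable χ) :
    Measurable (fun p : ℝ × E N => (u p.2 p.1 + l) ^ α * f p.2 * χ p.1) := by
  have hu1 : Measurable (fun p : ℝ × E N => u p.2 p.1) :=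
    G.hum.comp (measurable_snd.prodMk measurable_fst)
  exact (((hu1.add_const l).pow_const α).mul (hfm.comp measurable_snd)).mul
    (hχ.comp measurable_fst)

lemma V_int2 (G : Glob N s Λ T K u x₀ r R J ψ l α M δ Cψ) {t : ℝ} (ht : t ∈ J) {f : E N → ℝ}
    (hfm : Measurable f) {m : ℝ} (hf : ∀ x, 0 ≤ f x ∧ f x ≤ m) (hχ : Measurable χ) :
    IntegrableOn (fun x => (u x t + l) ^ α * f x * χ t) (ball x₀ r) := by
  refine Measure.integrableOn_of_bounded (M := |χ t| * ((M + l) ^ α * m))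
    measure_ball_lt_top.ne
    ((G.V_meas hfm hχ).comp (measurable_const.prodMk measurable_id)).aestronglyMeasurable ?_
  refine (ae_restrict_iff' measurableSet_ball).2 (Filter.Eventually.of_forall ?_)
  intro x hx
  exact G.V_bd ht hf hx

lemma V_int1 (G : Glob N s Λ T K u x₀ r R J ψ l α M δ Cψ) {f : E N → ℝ}
    (hfm : Measurable f) {m : ℝ} (hf : ∀ x, 0 ≤ f x ∧ f x ≤ m) (hχ : Measurable χ) {c : ℝ}
    (hc : ∀ t ∈ J, |χ t| ≤ c) (hJf : volume J ≠ ⊤) :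
    IntegrableOn (fun t => ∫ x in ball x₀ r, (u x t + l) ^ α * f x * χ t) J := by
  have h3 : IntegrableOn (fun p : ℝ × E N => (u p.2 p.1 + l) ^ α * f p.2 * χ p.1)
      (J ×ˢ ball x₀ r) := by
    have hfin : volume (J ×ˢ ball x₀ r) ≠ ⊤ := by
      rw [Measure.volume_eq_prod, Measure.prod_prod]
      exact ENNReal.mul_ne_top hJf measure_ball_lt_top.ne
    refine Measure.integrableOn_of_bounded (M := c * ((M + l) ^ α * m)) hfin
      (G.V_meas hfm hχ).aestronglyMeasurable ?_
    refine (ae_restrict_iff' (G.hJm.prod measurableSet_ball)).2 (Filter.Eventually.of_forall ?_)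
    rintro ⟨t, x⟩ ⟨ht, hx⟩
    have ht' : t ∈ J := ht
    refine (G.V_bd (χ := χ) ht' hf hx).trans (mul_le_mul_of_nonneg_right (hc t ht') ?_)
    have := (hf x).1.trans (hf x).2
    have := G.M_nonneg ht'
    have := G.hl
    positivity
  unfold IntegrableOn at h3
  rw [Measure.volume_eq_prod, ← Measure.prod_restrict] at h3
  exact h3.integral_prod_left

lemma V_nonneg (G : Glob N s Λ T K u x₀ r R J ψ l α M δ Cψ) {t : ℝ} (ht : t ∈ J)
    {f : E N → ℝ} (hf : ∀ x, 0 ≤ f x) (hχ : 0 ≤ χ t) :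
    0 ≤ ∫ x in ball x₀ r, (u x t + l) ^ α * f x * χ t := by
  apply setIntegral_nonneg measurableSet_ball
  intro x hx
  exact mul_nonneg (mul_nonneg (G.vbd (G.hAB hx) ht).1 (hf x)) hχ

end Glob

namespace Glob
variable {N : ℕ} {s Λ T : ℝ} {K : E N → E N → ℝ → ℝ} {u : E N → ℝ → ℝ} {x₀ : E N}
    {r R : ℝ} {J : Set ℝ} {ψ : E N → ℝ} {l α M δ Cψ : ℝ} {χ : ℝ → ℝ}

lemma ind_um (G : Glob N s Λ T K u x₀ r R J ψ l α M δ Cψ) {t : ℝ} (ht : t ∈ J) (y : E N) :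
    0 ≤ (ball x₀ R)ᶜ.indicator (fun y => uminus N u y t) y ∧
      (ball x₀ R)ᶜ.indicator (fun y => uminus N u y t) y ≤ M ∧
      -(u y t) ≤ (ball x₀ R)ᶜ.indicator (fun y => uminus N u y t) y := by
  have hM := G.M_nonneg ht
  by_cases hy : y ∈ ball x₀ R
  · have : y ∉ (ball x₀ R)ᶜ := fun h => h hy
    rw [indicator_of_notMem this]
    exact ⟨le_rfl, hM, by linarith [G.hpos y hy t ht]⟩
  · have : y ∈ (ball x₀ R)ᶜ := hy
    rw [indicator_of_mem this]
    exact ⟨(G.um_le ht y).1, (G.um_le ht y).2, le_max_left _ _⟩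

lemma h2_meas (G : Glob N s Λ T K u x₀ r R J ψ l α M δ Cψ) (t : ℝ) :
    Measurable (fun q : E N × E N => h2F s Λ u l α ψ χ (ball x₀ R) t q) := by
  have hu := G.um_meas t
  have hψ := G.hψ.continuous.measurable
  have h1 : Measurable (fun q : E N × E N => (u q.1 t + l) ^ α * ψ q.1 ^ 2 * χ t) :=
    ((((hu.comp measurable_fst).add_const l).pow_const α).mul
      ((hψ.comp measurable_fst).pow_const 2)).mul_const _
  have h2 : Measurable ((ball x₀ R)ᶜ.indicator (fun y => uminus N u y t)) :=
    (hu.neg.max measurable_const).indicator measurableSet_ball.compl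
  have h3 : Measurable (fun q : E N × E N => ‖q.1 - q.2‖ ^ (-((N : ℝ) + 2 * s))) :=
    (measurable_fst.sub measurable_snd).norm.pow_const _
  exact h1.mul (measurable_const.mul ((measurable_const.add
    (measurable_const.mul (h2.comp measurable_snd))).mul h3))

lemma h2_bd (G : Glob N s Λ T K u x₀ r R J ψ l α M δ Cψ) {t : ℝ} (ht : t ∈ J)
    {q : E N × E N} (hq : q ∈ ball x₀ r ×ˢ (ball x₀ r)ᶜ) :
    |h2F s Λ u l α ψ χ (ball x₀ R) t q| ≤
      (|χ t| * ((M + l) ^ α * Cψ)) * (Λ * ((1 + l⁻¹ * M) * δ⁻¹ ^ 2)) * kk N s (ball x₀ r) q := by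
  obtain ⟨x, y⟩ := q
  have hx : x ∈ ball x₀ r := hq.1
  have hy : y ∉ ball x₀ r := hq.2
  have hkk := kk_nonneg N s (ball x₀ r) (x, y)
  have hΛ := G.hΛ
  have hl := G.hl
  have hM := G.M_nonneg ht
  have hδ := G.hδ0
  have hC := G.hCψ0
  by_cases hxs : x ∈ tsupport ψ
  swap
  · have : ψ x = 0 := image_eq_zero_of_notMem_tsupport hxs
    simp only [h2F, this]
    simp
    positivity
  have hi := G.ind_um ht y
  have hv := G.V_bd (χ := χ) ht (f := fun x => ψ x ^ 2) (m := Cψ)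
    (fun x => ⟨sq_nonneg _, G.hψM x⟩) hx
  unfold h2F
  simp only
  set w := (ball x₀ R)ᶜ.indicator (fun y => uminus N u y t) y
  have hw := hi.1
  rw [abs_mul, mul_assoc (|χ t| * ((M + l) ^ α * Cψ))]
  refine mul_le_mul hv ?_ (abs_nonneg _) (by positivity)
  have hk0 : 0 ≤ ‖x - y‖ ^ (-((N : ℝ) + 2 * s)) := by positivity
  rw [abs_of_nonneg (by positivity)]
  have hk := (G.k_far (G.hδ x hxs y hy)).trans
    (mul_le_mul_of_nonneg_left (kap_le_kk_left (s := s) hx) (by positivity))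
  have h1 : 1 + l⁻¹ * w ≤ 1 + l⁻¹ * M := by
    have := mul_le_mul_of_nonneg_left hi.2.1 (inv_nonneg.2 hl.le)
    linarith
  calc _ ≤ Λ * ((1 + l⁻¹ * M) * (δ⁻¹ ^ 2 * kk N s (ball x₀ r) (x, y))) := by
        apply mul_le_mul_of_nonneg_left _ (by positivity)
        exact mul_le_mul h1 hk hk0 (by positivity)
    _ = _ := by ring

lemma h2_int2 (G : Glob N s Λ T K u x₀ r R J ψ l α M δ Cψ) {t : ℝ} (ht : t ∈ J) :
    IntegrableOn (fun q : E N × E N => h2F s Λ u l α ψ χ (ball x₀ R) t q)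
      (ball x₀ r ×ˢ (ball x₀ r)ᶜ) := by
  refine Integrable.mono' ((G.kk_int.const_mul
    ((|χ t| * ((M + l) ^ α * Cψ)) * (Λ * ((1 + l⁻¹ * M) * δ⁻¹ ^ 2))))).integrableOn
    (G.h2_meas t).aestronglyMeasurable ?_
  refine (ae_restrict_iff' (measurableSet_ball.prod measurableSet_ball.compl)).2
    (Filter.Eventually.of_forall ?_)
  intro q hq
  exact G.h2_bd ht hq

lemma inner_le (G : Glob N s Λ T K u x₀ r R J ψ l α M δ Cψ) {t : ℝ} (ht : t ∈ J) {x : E N}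
    (hx : x ∈ tsupport ψ) :
    ∫ y in (ball x₀ r)ᶜ, (1 + l⁻¹ * (ball x₀ R)ᶜ.indicator (fun y => uminus N u y t) y) *
      ‖x - y‖ ^ (-((N : ℝ) + 2 * s)) ≤ sup1 N s x₀ r ψ + l⁻¹ * sup2 N s u x₀ R ψ t := by
  have hsub : (ball x₀ R)ᶜ ⊆ (ball x₀ r)ᶜ := compl_subset_compl.2 G.hAB
  have e : ∀ y, (1 + l⁻¹ * (ball x₀ R)ᶜ.indicator (fun y => uminus N u y t) y) *
      ‖x - y‖ ^ (-((N : ℝ) + 2 * s)) = ‖x - y‖ ^ (-((N : ℝ) + 2 * s)) +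
      l⁻¹ * (ball x₀ R)ᶜ.indicator
        (fun y => uminus N u y t * ‖x - y‖ ^ (-((N : ℝ) + 2 * s))) y := by
    intro y
    by_cases hy : y ∈ (ball x₀ R)ᶜ
    · rw [indicator_of_mem hy, indicator_of_mem hy]; ring
    · rw [indicator_of_notMem hy, indicator_of_notMem hy]; ring
  simp_rw [e]
  have hi : Integrable ((ball x₀ R)ᶜ.indicator
        (fun y => uminus N u y t * ‖x - y‖ ^ (-((N : ℝ) + 2 * s)))) :=
    (integrable_indicator_iff measurableSet_ball.compl).2 (G.uk_int hx ht)
  rw [integral_add (G.k_int hx) (hi.const_mul _).integrableOn, integral_const_mul,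
    setIntegral_indicator measurableSet_ball.compl, inter_eq_right.2 hsub]
  have hl := G.hl
  have a1 : ∫ y in (ball x₀ r)ᶜ, ‖x - y‖ ^ (-((N : ℝ) + 2 * s)) ≤ sup1 N s x₀ r ψ :=
    le_biSup_real (f := fun x => ∫ y in (ball x₀ r)ᶜ, ‖x - y‖ ^ (-((N : ℝ) + 2 * s)))
      (fun x hx => G.I1_bd hx) hx
  have a2 : ∫ y in (ball x₀ R)ᶜ, uminus N u y t * ‖x - y‖ ^ (-((N : ℝ) + 2 * s)) ≤
      sup2 N s u x₀ R ψ t :=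
    le_biSup_real (f := fun x => ∫ y in (ball x₀ R)ᶜ, uminus N u y t *
      ‖x - y‖ ^ (-((N : ℝ) + 2 * s))) (fun x hx => G.I2_bd hx ht) hx
  exact add_le_add a1 (mul_le_mul_of_nonneg_left a2 (inv_nonneg.2 hl.le))

lemma h2_le (G : Glob N s Λ T K u x₀ r R J ψ l α M δ Cψ) {t : ℝ} (ht : t ∈ J)
    (hχm : Measurable χ) (hχ0 : 0 ≤ χ t) :
    ∫ q in ball x₀ r ×ˢ (ball x₀ r)ᶜ, h2F s Λ u l α ψ χ (ball x₀ R) t q ≤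
      Λ * (sup1 N s x₀ r ψ + l⁻¹ * sup2 N s u x₀ R ψ t) *
        ∫ x in ball x₀ r, (u x t + l) ^ α * ψ x ^ 2 * χ t := by
  have hi2 := G.h2_int2 (χ := χ) ht
  rw [Measure.volume_eq_prod, setIntegral_prod _ hi2, ← integral_const_mul]
  have hi3 := hi2
  unfold IntegrableOn at hi3
  rw [Measure.volume_eq_prod, ← Measure.prod_restrict] at hi3
  apply setIntegral_mono_on hi3.integral_prod_left
    ((G.V_int2 ht (f := fun x => ψ x ^ 2) (m := Cψ) (G.hψ.continuous.measurable.pow_const 2)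
      (fun x => ⟨sq_nonneg _, G.hψM x⟩) hχm).const_mul _) measurableSet_ball
  intro x hx
  simp only [h2F]
  rw [integral_const_mul, integral_const_mul]
  have hW : 0 ≤ (u x t + l) ^ α * ψ x ^ 2 * χ t :=
    mul_nonneg (mul_nonneg (G.vbd (G.hAB hx) ht).1 (sq_nonneg _)) hχ0
  by_cases hxs : x ∈ tsupport ψ
  · have := G.inner_le ht hxs
    have hΛ := G.hΛ
    calc _ ≤ (u x t + l) ^ α * ψ x ^ 2 * χ t *
        (Λ * (sup1 N s x₀ r ψ + l⁻¹ * sup2 N s u x₀ R ψ t)) :=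
          mul_le_mul_of_nonneg_left (mul_le_mul_of_nonneg_left this (by positivity)) hW
      _ = _ := by ring
  · have : ψ x = 0 := image_eq_zero_of_notMem_tsupport hxs
    simp [this]

lemma nl_swap (G : Glob N s Λ T K u x₀ r R J ψ l α M δ Cψ) (t : ℝ) (x y : E N) :
    nlF K u l α ψ χ t (x, y) = nlF K u l α ψ χ t (y, x) := by
  unfold nlF
  simp only
  rw [G.hK.2.1 x y t]
  ring

lemma nl_far (G : Glob N s Λ T K u x₀ r R J ψ l α M δ Cψ) {t : ℝ} (ht : t ∈ J)
    (hχ0 : 0 ≤ χ t) {x y : E N} (hx : x ∈ ball x₀ r) (hy : y ∉ ball x₀ r) :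
    nlF K u l α ψ χ t (x, y) ≤ h2F s Λ u l α ψ χ (ball x₀ R) t (x, y) := by
  have hxy : x ≠ y := fun h => hy (h ▸ hx)
  have hψy : ψ y = 0 := image_eq_zero_of_notMem_tsupport (fun h => hy (G.hψA h))
  have hK := (G.hK.2.2 x y hxy t (G.hJT ht)).2
  have hK0 := G.K_nonneg hxy (G.hJT ht)
  have hi := G.ind_um ht y
  have hux := G.hpos x (G.hAB hx) t ht
  have hl := G.hl
  have hΛ := G.hΛ
  unfold nlF h2F tst
  simp only [hψy]
  set w := (ball x₀ R)ᶜ.indicator (fun y => uminus N u y t) y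
  set v := u x t + l with hv
  have hvl : l ≤ v := by linarith
  have hv0 : 0 < v := by linarith
  have hva : v ^ α = v ^ (α - 1) * v := by
    rw [← Real.rpow_add_one hv0.ne']; congr 1; ring
  have hp : 0 ≤ v ^ (α - 1) := by positivity
  set k := ‖x - y‖ ^ (-((N : ℝ) + 2 * s)) with hk
  have hk0 : 0 ≤ k := by positivity
  have hw := hi.1
  have h1 : u x t - u y t ≤ v * (1 + l⁻¹ * w) := by
    have : w ≤ v * (l⁻¹ * w) := by
      rw [← mul_assoc]
      apply le_mul_of_one_le_left hw
      rw [← div_eq_mul_inv, le_div_iff₀ hl]; linarith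
    nlinarith [hi.2.2]
  have hP : 0 ≤ v ^ (α - 1) * (ψ x ^ 2 * χ t) := mul_nonneg hp (mul_nonneg (sq_nonneg _) hχ0)
  calc (u x t - u y t) * (v ^ (α - 1) * (ψ x ^ 2 * χ t) -
        (u y t + l) ^ (α - 1) * ((0:ℝ) ^ 2 * χ t)) * K x y t
      = (u x t - u y t) * (v ^ (α - 1) * (ψ x ^ 2 * χ t) * K x y t) := by ring
    _ ≤ (v * (1 + l⁻¹ * w)) * (v ^ (α - 1) * (ψ x ^ 2 * χ t) * K x y t) :=
        mul_le_mul_of_nonneg_right h1 (mul_nonneg hP hK0)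
    _ ≤ (v * (1 + l⁻¹ * w)) * (v ^ (α - 1) * (ψ x ^ 2 * χ t) * (Λ * k)) :=
        mul_le_mul_of_nonneg_left (mul_le_mul_of_nonneg_left hK hP) (by positivity)
    _ = _ := by rw [hva]; ring

lemma nl_near (G : Glob N s Λ T K u x₀ r R J ψ l α M δ Cψ) {t : ℝ} (ht : t ∈ J)
    (hχ0 : 0 ≤ χ t) {x y : E N} (hx : x ∈ ball x₀ r) (hy : y ∈ ball x₀ r) :
    nlF K u l α ψ χ t (x, y) ≤
      (4 * (1 - α) / α + 9 / (1 - α)) * h1F K u l α ψ χ t (x, y) := by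
  by_cases hxy : x = y
  · subst hxy; simp [nlF, h1F]
  have hK0 := G.K_nonneg hxy (G.hJT ht)
  have hux := G.hpos x (G.hAB hx) t ht
  have huy := G.hpos y (G.hAB hy) t ht
  have hl := G.hl
  have h := alg_ineq (u x t + l) (u y t + l) (ψ x) (ψ y) α (by linarith) (by linarith) G.h0 G.h1
  unfold nlF h1F tst
  simp only
  have h' := mul_le_mul_of_nonneg_right h (mul_nonneg hχ0 hK0)
  calc _ = _ := ?_
    _ ≤ _ := h'
    _ = _ := ?_
  · ring
  · ring

/-- slice inequality -/
lemma nl_slice (G : Glob N s Λ T K u x₀ r R J ψ l α M δ Cψ)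
    (L : Loc N u l α ψ χ (ball x₀ R) J) {t : ℝ} (ht : t ∈ J) :
    ∫ x, ∫ y, nlF K u l α ψ χ t (x, y) ≤
      (4 * (1 - α) / α + 9 / (1 - α)) *
        (∫ x in ball x₀ r, ∫ y in ball x₀ r, h1F K u l α ψ χ t (x, y)) +
      2 * Λ * (sup1 N s x₀ r ψ + l⁻¹ * sup2 N s u x₀ R ψ t) *
        ∫ x in ball x₀ r, (u x t + l) ^ α * ψ x ^ 2 * χ t := by
  have hχm : Measurable χ := L.hχ.continuous.measurable
  have hχ0 := L.hχ0 t
  rw [G.nl_iter L, G.h1_iter hχm ht]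
  set A := ball x₀ r with hA
  have hAm : MeasurableSet A := measurableSet_ball
  set H1 := (A ×ˢ A).indicator (fun q => h1F K u l α ψ χ t q) with hH1
  set H2 := (A ×ˢ Aᶜ).indicator (fun q => h2F s Λ u l α ψ χ (ball x₀ R) t q) with hH2
  have i1 : Integrable H1 := (integrable_indicator_iff (hAm.prod hAm)).2 (G.h1_int2 hχm ht)
  have i2 : Integrable H2 := (integrable_indicator_iff (hAm.prod hAm.compl)).2 (G.h2_int2 ht)
  have i3 : Integrable (fun q : E N × E N => H2 q.swap) := i2.swap
  have key : ∀ q, nlF K u l α ψ χ t q ≤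
      (4 * (1 - α) / α + 9 / (1 - α)) * H1 q + H2 q + H2 q.swap := by
    rintro ⟨x, y⟩
    by_cases hx : x ∈ A <;> by_cases hy : y ∈ A
    · simp only [hH1, hH2, Prod.swap_prod_mk]
      rw [indicator_of_mem (mk_mem_prod hx hy), indicator_of_notMem (fun h => h.2 hy),
        indicator_of_notMem (fun h => h.2 hx), add_zero, add_zero]
      exact G.nl_near ht hχ0 hx hy
    · simp only [hH1, hH2, Prod.swap_prod_mk]
      rw [indicator_of_notMem (fun h => hy h.2), indicator_of_mem (mk_mem_prod hx hy),
        indicator_of_notMem (fun h => hy h.1), add_zero, mul_zero, zero_add]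
      exact G.nl_far ht hχ0 hx hy
    · simp only [hH1, hH2, Prod.swap_prod_mk]
      rw [indicator_of_notMem (fun h => hx h.1), indicator_of_notMem (fun h => hx h.1),
        indicator_of_mem (mk_mem_prod hy hx), add_zero, mul_zero, zero_add, G.nl_swap]
      exact G.nl_far ht hχ0 hy hx
    · simp only [hH1, hH2, Prod.swap_prod_mk]
      rw [indicator_of_notMem (fun h => hx h.1), indicator_of_notMem (fun h => hx h.1),
        indicator_of_notMem (fun h => hy h.1), add_zero, mul_zero, zero_add]
      have e1 : ψ x = 0 := image_eq_zero_of_notMem_tsupport (fun h => hx (G.hψA h))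
      have e2 : ψ y = 0 := image_eq_zero_of_notMem_tsupport (fun h => hy (G.hψA h))
      simp [nlF, tst, e1, e2]
  have h2le := G.h2_le ht hχm hχ0
  rw [← integral_indicator (hAm.prod hAm.compl)] at h2le
  have hsw : ∫ q : E N × E N, H2 q.swap = ∫ q, H2 q := by
    rw [Measure.volume_eq_prod]
    exact integral_prod_swap H2
  calc _ ≤ ∫ q, ((4 * (1 - α) / α + 9 / (1 - α)) * H1 q + H2 q + H2 q.swap) :=
        integral_mono (G.nl_int2 L t) (((i1.const_mul _).add i2).add i3) key
    _ = (4 * (1 - α) / α + 9 / (1 - α)) * (∫ q, H1 q) + (∫ q, H2 q) + ∫ q, H2 q := by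
        have a1 := integral_add ((i1.const_mul (4 * (1 - α) / α + 9 / (1 - α))).add i2) i3
        have a2 := integral_add (i1.const_mul (4 * (1 - α) / α + 9 / (1 - α))) i2
        rw [integral_const_mul] at a2
        rw [hsw] at a1
        simp only [Pi.add_apply] at a1
        rw [a1, a2]
    _ ≤ _ := by
        rw [integral_indicator (hAm.prod hAm)]
        change ∫ q, H2 q ≤ _ at h2le
        linarith

end Glob

/-- smooth truncation -/
def FF (ε z : ℝ) : ℝ := ∫ y in (0 : ℝ)..z, Real.smoothTransition ((y - ε) / ε)

lemma st_smooth (c d : ℝ) :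
    ContDiff ℝ (⊤ : ℕ∞) (fun y : ℝ => Real.smoothTransition ((y - c) / d)) :=
  Real.smoothTransition.contDiff.comp ((contDiff_id.sub contDiff_const).div_const _)

lemma FF_deriv (ε z : ℝ) : HasDerivAt (FF ε) (Real.smoothTransition ((z - ε) / ε)) z := by
  have hc := (st_smooth ε ε).continuous
  exact intervalIntegral.integral_hasDerivAt_right (hc.intervalIntegrable _ _)
    (hc.stronglyMeasurableAtFilter _ _) hc.continuousAt

lemma FF_smooth (ε : ℝ) : ContDiff ℝ (⊤ : ℕ∞) (FF ε) := by
  refine contDiff_infty_iff_deriv.2 ⟨fun z => (FF_deriv ε z).differentiableAt, ?_⟩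
  have : deriv (FF ε) = fun z => Real.smoothTransition ((z - ε) / ε) :=
    funext fun z => (FF_deriv ε z).deriv
  rw [this]
  exact st_smooth ε ε

lemma FF_bounds {ε z : ℝ} (hz : 0 ≤ z) : 0 ≤ FF ε z ∧ FF ε z ≤ z := by
  have hc := (st_smooth ε ε).continuous
  constructor
  · exact intervalIntegral.integral_nonneg hz (fun y _ => Real.smoothTransition.nonneg _)
  · have := intervalIntegral.integral_mono_on (μ := volume) hz (hc.intervalIntegrable 0 z)
      (continuous_const.intervalIntegrable (μ := volume) 0 z)
      (fun y _ => Real.smoothTransition.le_one ((y - ε) / ε))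
    simpa [FF] using this

lemma FF_zero {ε z : ℝ} (hε : 0 < ε) (hz : 0 ≤ z) (hz1 : z ≤ ε) : FF ε z = 0 := by
  unfold FF
  rw [intervalIntegral.integral_congr (g := fun _ => (0 : ℝ))]
  · simp
  · intro y hy
    rw [uIcc_of_le hz] at hy
    apply Real.smoothTransition.zero_of_nonpos
    exact div_nonpos_of_nonpos_of_nonneg (by linarith [hy.2]) hε.le

lemma FF_large {ε z : ℝ} (hε : 0 < ε) (hz : 4 * ε ≤ z) : z / 2 ≤ FF ε z := by
  have hc := (st_smooth ε ε).continuous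
  have h1 : FF ε z = FF ε (2 * ε) +
      ∫ y in (2 * ε)..z, Real.smoothTransition ((y - ε) / ε) :=
    (intervalIntegral.integral_add_adjacent_intervals (hc.intervalIntegrable _ _)
      (hc.intervalIntegrable _ _)).symm
  have h2 : ∫ y in (2 * ε)..z, Real.smoothTransition ((y - ε) / ε) = z - 2 * ε := by
    rw [intervalIntegral.integral_congr (g := fun _ => (1 : ℝ))]
    · simp
    · intro y hy
      rw [uIcc_of_le (by linarith)] at hy
      apply Real.smoothTransition.one_of_one_le
      rw [le_div_iff₀ hε]; linarith [hy.1]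
  have h3 := (FF_bounds (ε := ε) (z := 2 * ε) (by linarith)).1
  rw [h1, h2]; linarith

lemma exists_cutoff {η : ℝ → ℝ} {τ₁ τ₃ a ε : ℝ} (hη : ContDiff ℝ (⊤ : ℕ∞) η)
    (hη0 : ∀ t, 0 ≤ η t) (hη2 : ∀ t, τ₃ ≤ t → η t = 0) (ha : τ₁ < a) (hε : 0 < ε) :
    ∃ χ : ℝ → ℝ, ContDiff ℝ (⊤ : ℕ∞) χ ∧ HasCompactSupport χ ∧ tsupport χ ⊆ Ioo τ₁ τ₃ ∧
      (∀ t, 0 ≤ χ t) ∧ (∀ t, χ t ≤ η t) ∧ (∀ t, -deriv χ t ≤ |deriv η t|) ∧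
      ∀ t, a ≤ t → 4 * ε ≤ η t → η t / 2 ≤ χ t := by
  set c := (τ₁ + a) / 2 with hc
  have hca : 0 < a - c := by rw [hc]; linarith
  set θ : ℝ → ℝ := fun t => Real.smoothTransition ((t - c) / (a - c)) with hθ
  have hθs : ContDiff ℝ (⊤ : ℕ∞) θ := st_smooth c (a - c)
  have hFs : ContDiff ℝ (⊤ : ℕ∞) (fun t => FF ε (η t)) := (FF_smooth ε).comp hη
  have hθ0 : ∀ t, 0 ≤ θ t := fun t => Real.smoothTransition.nonneg _
  have hθ1 : ∀ t, θ t ≤ 1 := fun t => Real.smoothTransition.le_one _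
  have hmono : Monotone θ := by
    intro x y hxy
    apply Real.smoothTransition.monotone
    gcongr
  have hsub : tsupport (fun t => θ t * FF ε (η t)) ⊆ Ici c ∩ η ⁻¹' (Ici ε) := by
    apply closure_minimal
    · intro t ht
      rw [Function.mem_support] at ht
      constructor
      · by_contra hcon
        apply ht
        have : θ t = 0 := Real.smoothTransition.zero_of_nonpos
          (div_nonpos_of_nonpos_of_nonneg (by rw [mem_Ici] at hcon; linarith) hca.le)
        rw [this, zero_mul]
      · by_contra hcon
        apply ht
        have : FF ε (η t) = 0 := FF_zero hε (hη0 t)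
          (by rw [mem_preimage, mem_Ici] at hcon; linarith)
        rw [this, mul_zero]
    · exact isClosed_Ici.inter (isClosed_Ici.preimage hη.continuous)
  have hlt : ∀ t, ε ≤ η t → t < τ₃ := by
    intro t ht
    by_contra hcon
    have := hη2 t (not_lt.1 hcon)
    linarith
  refine ⟨fun t => θ t * FF ε (η t), hθs.mul hFs, ?_, ?_, ?_, ?_, ?_, ?_⟩
  · refine IsCompact.of_isClosed_subset (isCompact_Icc (a := c) (b := τ₃)) (isClosed_tsupport _) ?_
    intro t ht
    exact ⟨(hsub ht).1, (hlt t (hsub ht).2).le⟩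
  · intro t ht
    refine ⟨?_, hlt t (hsub ht).2⟩
    have : c ≤ t := (hsub ht).1
    linarith
  · intro t
    exact mul_nonneg (hθ0 t) (FF_bounds (hη0 t)).1
  · intro t
    have := FF_bounds (ε := ε) (hη0 t)
    exact (mul_le_of_le_one_left this.1 (hθ1 t)).trans this.2
  · intro t
    have d1 : HasDerivAt θ (deriv θ t) t :=
      (hθs.differentiable (by simp) t).hasDerivAt
    have d2 : HasDerivAt η (deriv η t) t := (hη.differentiable (by simp) t).hasDerivAt
    have d3 : HasDerivAt (fun t => FF ε (η t)) _ t := (FF_deriv ε (η t)).comp t d2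
    have d4 : deriv (fun t => θ t * FF ε (η t)) t = _ := (d1.mul d3).deriv
    rw [d4]
    have e1 : 0 ≤ deriv θ t := hmono.deriv_nonneg
    have e2 := (FF_bounds (ε := ε) (hη0 t)).1
    have e3 := mul_nonneg e1 e2
    have e4 : -(θ t * (Real.smoothTransition ((η t - ε) / ε) * deriv η t)) ≤ |deriv η t| := by
      have f0 : 0 ≤ θ t * Real.smoothTransition ((η t - ε) / ε) :=
        mul_nonneg (hθ0 t) (Real.smoothTransition.nonneg _)
      have f1 : θ t * Real.smoothTransition ((η t - ε) / ε) ≤ 1 :=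
        mul_le_one₀ (hθ1 t) (Real.smoothTransition.nonneg _) (Real.smoothTransition.le_one _)
      rw [← mul_assoc, ← mul_neg]
      calc _ ≤ θ t * Real.smoothTransition ((η t - ε) / ε) * |deriv η t| :=
            mul_le_mul_of_nonneg_left (neg_le_abs _) f0
        _ ≤ _ := mul_le_of_le_one_left (abs_nonneg _) f1
    linarith
  · intro t hat h4
    have : θ t = 1 := Real.smoothTransition.one_of_one_le
      (by rw [le_div_iff₀ hca]; linarith)
    simp only [this, one_mul]
    exact FF_large hε h4

namespace Glob
variable {N : ℕ} {s Λ T : ℝ} {K : E N → E N → ℝ → ℝ} {u : E N → ℝ → ℝ} {x₀ : E N}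
    {r R : ℝ} {J : Set ℝ} {ψ : E N → ℝ} {l α M δ Cψ : ℝ} {χ η : ℝ → ℝ}

lemma sup1_nonneg : 0 ≤ sup1 N s x₀ r ψ :=
  biSup_nonneg_real (fun x => integral_nonneg (fun y => by simp only [Pi.zero_apply]; positivity))

lemma sup2_nonneg (t : ℝ) : 0 ≤ sup2 N s u x₀ R ψ t :=
  biSup_nonneg_real (fun x => integral_nonneg (fun y =>
    mul_nonneg (le_max_right _ _) (by positivity)))

lemma sup2_ae (G : Glob N s Λ T K u x₀ r R J ψ l α M δ Cψ) :
    ∀ᵐ t ∂(volume.restrict J), sup2 N s u x₀ R ψ t ≤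
      essSup (fun t => sup2 N s u x₀ R ψ t) (volume.restrict J) := by
  apply ae_le_essSup
  refine ⟨|M| * (δ⁻¹ ^ 2 * ∫ y, kap N s y), ?_⟩
  rw [Filter.eventually_map]
  refine (ae_restrict_iff' G.hJm).2 (Filter.Eventually.of_forall ?_)
  intro t ht
  have hk : 0 ≤ ∫ y, kap N s y := integral_nonneg (fun y => kap_nonneg _ _ _)
  apply biSup_le_real
  · intro x hx
    exact (G.I2_bd hx ht).trans (mul_le_mul_of_nonneg_right (le_abs_self M) (by positivity))
  · positivity

lemma sup2_ess_nonneg (G : Glob N s Λ T K u x₀ r R J ψ l α M δ Cψ) (hJ : volume J ≠ 0) :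
    0 ≤ essSup (fun t => sup2 N s u x₀ R ψ t) (volume.restrict J) := by
  have h := G.sup2_ae
  have hne : volume.restrict J ≠ 0 := by
    rw [Ne, Measure.restrict_eq_zero]; exact hJ
  have : (ae (volume.restrict J)).NeBot := ae_neBot.2 hne
  obtain ⟨t, ht⟩ := h.exists
  exact (sup2_nonneg t).trans ht

lemma P_mono (G : Glob N s Λ T K u x₀ r R J ψ l α M δ Cψ) (hχ : Measurable χ)
    (hη : Measurable η) {t : ℝ} (ht : t ∈ J) (hle : χ t ≤ η t) :
    ∫ x in ball x₀ r, ∫ y in ball x₀ r, h1F K u l α ψ χ t (x, y) ≤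
    ∫ x in ball x₀ r, ∫ y in ball x₀ r, h1F K u l α ψ η t (x, y) := by
  rw [G.h1_iter hχ ht, G.h1_iter hη ht]
  apply setIntegral_mono_on (G.h1_int2 hχ ht) (G.h1_int2 hη ht)
    (measurableSet_ball.prod measurableSet_ball)
  rintro ⟨x, y⟩ ⟨hx, hy⟩
  have v1 := G.vbd (G.hAB hx) ht
  have v2 := G.vbd (G.hAB hy) ht
  unfold h1F
  by_cases h : x = y
  · subst h; simp
  · exact mul_le_mul_of_nonneg_right (mul_le_mul_of_nonneg_left hle
      (mul_nonneg (sq_nonneg _) (add_nonneg v1.1 v2.1))) (G.K_nonneg h (G.hJT ht))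

lemma V_mono (G : Glob N s Λ T K u x₀ r R J ψ l α M δ Cψ) (hχ : Measurable χ)
    (hη : Measurable η) {f : E N → ℝ} (hfm : Measurable f) {m : ℝ}
    (hf : ∀ x, 0 ≤ f x ∧ f x ≤ m) {t : ℝ} (ht : t ∈ J) (hle : χ t ≤ η t) :
    ∫ x in ball x₀ r, (u x t + l) ^ α * f x * χ t ≤
    ∫ x in ball x₀ r, (u x t + l) ^ α * f x * η t := by
  apply setIntegral_mono_on (G.V_int2 ht hfm hf hχ) (G.V_int2 ht hfm hf hη) measurableSet_ball
  intro x hx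
  exact mul_le_mul_of_nonneg_left hle (mul_nonneg (G.vbd (G.hAB hx) ht).1 (hf x).1)

/-- the bracket on the right-hand side -/
def bracket (N : ℕ) (s Λ : ℝ) (K : E N → E N → ℝ → ℝ) (u : E N → ℝ → ℝ) (x₀ : E N)
    (r R : ℝ) (J : Set ℝ) (ψ : E N → ℝ) (l α : ℝ) (η : ℝ → ℝ) : ℝ :=
  (4 * (1 - α) / α + 9 / (1 - α)) *
      (∫ t in J, ∫ x in ball x₀ r, ∫ y in ball x₀ r, h1F K u l α ψ η t (x, y))
    + 2 * Λ * sup1 N s x₀ r ψ *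
      (∫ t in J, ∫ x in ball x₀ r, (u x t + l) ^ α * ψ x ^ 2 * η t)
    + (2 * Λ / l) * essSup (fun t => sup2 N s u x₀ R ψ t) (volume.restrict J) *
      (∫ t in J, ∫ x in ball x₀ r, (u x t + l) ^ α * ψ x ^ 2 * η t)
    + (2 / (1 - α)) *
      (∫ t in J, ∫ x in ball x₀ r, (u x t + l) ^ α * ‖gradient ψ x‖ ^ 2 * η t)
    + (1 / α) *
      (∫ t in J, ∫ x in ball x₀ r, (u x t + l) ^ α * ψ x ^ 2 * |deriv η t|)

lemma bracket_nonneg (G : Glob N s Λ T K u x₀ r R J ψ l α M δ Cψ) (hJ0 : volume J ≠ 0)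
    (hη0 : ∀ t, 0 ≤ η t) : 0 ≤ bracket N s Λ K u x₀ r R J ψ l α η := by
  have h0 := G.h0
  have h1 : 0 < 1 - α := sub_pos.2 G.h1
  have hl := G.hl
  have hΛ := G.hΛ
  have hS1 : 0 ≤ sup1 N s x₀ r ψ := sup1_nonneg
  have hS2 := G.sup2_ess_nonneg hJ0
  have a1 : 0 ≤ ∫ t in J, ∫ x in ball x₀ r, ∫ y in ball x₀ r, h1F K u l α ψ η t (x, y) :=
    setIntegral_nonneg G.hJm (fun t ht => setIntegral_nonneg measurableSet_ball (fun x hx =>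
      setIntegral_nonneg measurableSet_ball (fun y hy => G.h1_nonneg ht (hη0 t) hx hy)))
  have a2 : 0 ≤ ∫ t in J, ∫ x in ball x₀ r, (u x t + l) ^ α * ψ x ^ 2 * η t :=
    setIntegral_nonneg G.hJm (fun t ht =>
      G.V_nonneg ht (f := fun x => ψ x ^ 2) (fun x => sq_nonneg _) (hη0 t))
  have a3 : 0 ≤ ∫ t in J, ∫ x in ball x₀ r, (u x t + l) ^ α * ‖gradient ψ x‖ ^ 2 * η t :=
    setIntegral_nonneg G.hJm (fun t ht =>
      G.V_nonneg ht (f := fun x => ‖gradient ψ x‖ ^ 2) (fun x => sq_nonneg _) (hη0 t))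
  have a4 : 0 ≤ ∫ t in J, ∫ x in ball x₀ r, (u x t + l) ^ α * ψ x ^ 2 * |deriv η t| :=
    setIntegral_nonneg G.hJm (fun t ht =>
      G.V_nonneg (χ := fun t => |deriv η t|) ht (f := fun x => ψ x ^ 2)
        (fun x => sq_nonneg _) (abs_nonneg _))
  unfold bracket
  positivity

lemma trunc (G : Glob N s Λ T K u x₀ r R J ψ l α M δ Cψ)
    (L : Loc N u l α ψ χ (ball x₀ R) J) {Ω : Set (E N)} (hBΩ : ball x₀ R ⊆ Ω)
    (hu : IsWeakSupersolution N T K Ω u) (hη : ContDiff ℝ (⊤ : ℕ∞) η) {c : ℝ}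
    (hc : ∀ t ∈ J, |η t| ≤ c) {c' : ℝ} (hc' : ∀ t ∈ J, |deriv η t| ≤ c')
    (hJf : volume J ≠ ⊤) (hJ0 : volume J ≠ 0) (hle : ∀ t, χ t ≤ η t)
    (hd : ∀ t, -deriv χ t ≤ |deriv η t|) :
    (2 * (1 - α) / α ^ 2) * (∫ t in J, ∫ x in ball x₀ r,
        ‖gradient (fun y => (u y t + l) ^ (α / 2)) x‖ ^ 2 * ψ x ^ 2 * χ t) ≤
      bracket N s Λ K u x₀ r R J ψ l α η := by
  have h0 := G.h0
  have h1 : 0 < 1 - α := sub_pos.2 G.h1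
  have hl := G.hl
  have hΛ := G.hΛ
  have hS1 : 0 ≤ sup1 N s x₀ r ψ := sup1_nonneg
  have hS2 := G.sup2_ess_nonneg hJ0
  have hsup := hu.2.2.2 (tst u l α ψ χ) L.tst_smooth L.tst_cpt
    (L.tst_supp.trans (prod_mono (L.hψB.trans hBΩ) (L.hχJ.trans G.hJT))) L.tst_nonneg
  rw [L.time_eq hBΩ G.hψA G.hJT] at hsup
  have hgr := L.grad_le hBΩ G.hψA G.hJT
  have hnl := G.nl_restrict L
  simp only [nlF] at hnl
  rw [hnl] at hsup
  have hχm : Measurable χ := L.hχ.continuous.measurable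
  have hηm : Measurable η := hη.continuous.measurable
  have hdχ : Continuous (deriv χ) := L.hχ.continuous_deriv (by simp)
  have hdη : Continuous (deriv η) := hη.continuous_deriv (by simp)
  have hdηm : Measurable (fun t => |deriv η t|) := hdη.abs.measurable
  have hχc : ∀ t ∈ J, |χ t| ≤ c := by
    intro t ht
    rw [abs_of_nonneg (L.hχ0 t)]
    exact (hle t).trans ((le_abs_self _).trans (hc t ht))
  obtain ⟨d, hdb⟩ := L.hχc.deriv.exists_bound_of_continuous hdχ
  have hψ2m : Measurable (fun x => ψ x ^ 2) := G.hψ.continuous.measurable.pow_const 2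
  have hψ2 : ∀ x, 0 ≤ ψ x ^ 2 ∧ ψ x ^ 2 ≤ Cψ := fun x => ⟨sq_nonneg _, G.hψM x⟩
  have hgc : Continuous (fun x => gradient ψ x) := by
    unfold gradient
    exact (InnerProductSpace.toDual ℝ (E N)).symm.continuous.comp
      (G.hψ.continuous_fderiv (by simp))
  have hg2m : Measurable (fun x => ‖gradient ψ x‖ ^ 2) := hgc.norm.measurable.pow_const 2
  obtain ⟨m, hm⟩ : ∃ m, ∀ x, ‖gradient ψ x‖ ≤ m := by
    obtain ⟨m, hm⟩ := (G.hψc.fderiv ℝ).exists_bound_of_continuous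
      (G.hψ.continuous_fderiv (by simp))
    refine ⟨m, fun x => ?_⟩
    have := hm x
    simpa [gradient] using this
  have hg2 : ∀ x, 0 ≤ ‖gradient ψ x‖ ^ 2 ∧ ‖gradient ψ x‖ ^ 2 ≤ m ^ 2 := fun x =>
    ⟨sq_nonneg _, pow_le_pow_left₀ (norm_nonneg _) (hm x) 2⟩
  -- time term
  have t1 : -(∫ t in J, ∫ x in ball x₀ r, (u x t + l) ^ α * ψ x ^ 2 * deriv χ t) ≤
      ∫ t in J, ∫ x in ball x₀ r, (u x t + l) ^ α * ψ x ^ 2 * |deriv η t| := by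
    rw [← integral_neg]
    apply setIntegral_mono_on (G.V_int1 hψ2m hψ2 hdχ.measurable (c := d)
      (fun t _ => hdb t) hJf).neg
      (G.V_int1 (χ := fun t => |deriv η t|) hψ2m hψ2 hdηm (c := c')
        (fun t ht => by rw [abs_abs]; exact hc' t ht) hJf) G.hJm
    intro t ht
    have := G.V_mono (χ := fun t => -deriv χ t) (η := fun t => |deriv η t|)
      hdχ.neg.measurable hdηm hψ2m hψ2 ht (hd t)
    simp only [mul_neg] at this
    rw [integral_neg] at this
    exact this
  -- gradient of the cut-off
  have t2 : (∫ t in J, ∫ x in ball x₀ r, (u x t + l) ^ α * ‖gradient ψ x‖ ^ 2 * χ t) ≤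
      ∫ t in J, ∫ x in ball x₀ r, (u x t + l) ^ α * ‖gradient ψ x‖ ^ 2 * η t := by
    apply setIntegral_mono_on (G.V_int1 hg2m hg2 hχm hχc hJf) (G.V_int1 hg2m hg2 hηm hc hJf)
      G.hJm
    intro t ht
    exact G.V_mono hχm hηm hg2m hg2 ht (hle t)
  -- nonlocal term
  set S1 := sup1 N s x₀ r ψ with hS1d
  set S2 := essSup (fun t => sup2 N s u x₀ R ψ t) (volume.restrict J) with hS2d
  have i1 := G.h1_int1 hηm hc hJf
  have i2 := G.V_int1 hψ2m hψ2 hηm hc hJf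
  have t3 : (∫ t in J, ∫ x, ∫ y, nlF K u l α ψ χ t (x, y)) ≤
      ∫ t in J, ((4 * (1 - α) / α + 9 / (1 - α)) *
        (∫ x in ball x₀ r, ∫ y in ball x₀ r, h1F K u l α ψ η t (x, y)) +
        2 * Λ * (S1 + l⁻¹ * S2) * ∫ x in ball x₀ r, (u x t + l) ^ α * ψ x ^ 2 * η t) := by
    apply integral_mono_ae (G.nl_int1 L).integrableOn ((i1.const_mul _).add (i2.const_mul _))
    filter_upwards [G.sup2_ae, ae_restrict_mem G.hJm] with t hts ht
    refine (G.nl_slice L ht).trans ?_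
    have b1 := G.P_mono hχm hηm ht (hle t)
    have b2 := G.V_mono hχm hηm hψ2m hψ2 ht (hle t)
    have b3 := G.V_nonneg ht (fun x => (hψ2 x).1) (L.hχ0 t)
    have b4 := sup2_nonneg (N := N) (s := s) (u := u) (x₀ := x₀) (R := R) (ψ := ψ) t
    simp only [Pi.add_apply]
    apply add_le_add
    · exact mul_le_mul_of_nonneg_left b1 (by positivity)
    · have b5 : l⁻¹ * sup2 N s u x₀ R ψ t ≤ l⁻¹ * S2 :=
        mul_le_mul_of_nonneg_left hts (by positivity)
      refine mul_le_mul ?_ b2 b3 (by positivity)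
      apply mul_le_mul_of_nonneg_left _ (by positivity)
      linarith
  rw [integral_add (i1.const_mul _) (i2.const_mul _), integral_const_mul,
    integral_const_mul] at t3
  simp only [nlF] at t3
  have t1' := mul_le_mul_of_nonneg_left t1 (by positivity : 0 ≤ 1 / α)
  have t2' := mul_le_mul_of_nonneg_left t2 (by positivity : 0 ≤ 2 / (1 - α))
  unfold bracket
  rw [← hS1d, ← hS2d]
  have e : 2 * Λ * (S1 + l⁻¹ * S2) = 2 * Λ * S1 + 2 * Λ / l * S2 := by
    field_simp
  rw [e, add_mul] at t3
  linarith

end Glob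

lemma main_lim {N : ℕ} {s Λ T : ℝ} {K : E N → E N → ℝ → ℝ} {u : E N → ℝ → ℝ} {x₀ : E N}
    {r R τ₁ τ₃ : ℝ} {ψ : E N → ℝ} {l α M δ Cψ : ℝ} {η : ℝ → ℝ} {Ω : Set (E N)}
    (G : Glob N s Λ T K u x₀ r R (Ioo τ₁ τ₃) ψ l α M δ Cψ) (hττ : τ₁ < τ₃)
    (hBΩ : ball x₀ R ⊆ Ω)
    (hu : IsWeakSupersolution N T K Ω u) (hη : ContDiff ℝ (⊤ : ℕ∞) η)
    (hη0 : ∀ t, 0 ≤ η t) (hη2 : ∀ t, τ₃ ≤ t → η t = 0) :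
    (∫ t in Ioo τ₁ τ₃, ∫ x in ball x₀ r,
        ‖gradient (fun y => (u y t + l) ^ (α / 2)) x‖ ^ 2 * ψ x ^ 2 * η t) ≤
      α ^ 2 / (1 - α) * Glob.bracket N s Λ K u x₀ r R (Ioo τ₁ τ₃) ψ l α η := by
  set J := Ioo τ₁ τ₃ with hJ
  have h0 := G.h0
  have h1 : 0 < 1 - α := sub_pos.2 G.h1
  have hJf : volume J ≠ ⊤ := by rw [hJ, Real.volume_Ioo]; exact ENNReal.ofReal_ne_top
  have hJ0 : volume J ≠ 0 := by
    rw [hJ, Real.volume_Ioo]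
    exact (ENNReal.ofReal_pos.2 (by linarith)).ne'
  have hb0 := G.bracket_nonneg (η := η) hJ0 hη0
  by_cases hint : IntegrableOn (fun t => ∫ x in ball x₀ r,
        ‖gradient (fun y => (u y t + l) ^ (α / 2)) x‖ ^ 2 * ψ x ^ 2 * η t) J
  swap
  · rw [integral_undef hint]
    positivity
  set γ : ℝ → ℝ := fun t => ∫ x in ball x₀ r,
    ‖gradient (fun y => (u y t + l) ^ (α / 2)) x‖ ^ 2 * ψ x ^ 2 with hγ
  have hγ0 : ∀ t, 0 ≤ γ t := fun t => integral_nonneg (fun x => by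
    simp only [Pi.zero_apply]; positivity)
  simp_rw [integral_mul_const] at hint ⊢
  change IntegrableOn (fun t => γ t * η t) J at hint
  change ∫ t in J, γ t * η t ≤ _
  obtain ⟨c, hc⟩ := (isCompact_Icc (a := τ₁) (b := τ₃)).exists_bound_of_continuousOn
    hη.continuous.continuousOn
  have hdη : Continuous (deriv η) := hη.continuous_deriv (by simp)
  obtain ⟨c', hc'⟩ := (isCompact_Icc (a := τ₁) (b := τ₃)).exists_bound_of_continuousOn
    hdη.continuousOn
  set S : ℕ → Set ℝ := fun n => Ici (τ₁ + 1 / ((n : ℝ) + 1)) ∩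
    η ⁻¹' (Ici (4 * (1 / ((n : ℝ) + 1)))) with hS
  have hSm : ∀ n, MeasurableSet (S n) := fun n =>
    measurableSet_Ici.inter (hη.continuous.measurable measurableSet_Ici)
  have hbd : ∀ n, ∫ t in J, (S n).indicator (fun t => γ t * η t) t ≤
      α ^ 2 / (1 - α) * Glob.bracket N s Λ K u x₀ r R J ψ l α η := by
    intro n
    have hε : (0 : ℝ) < 1 / ((n : ℝ) + 1) := by positivity
    obtain ⟨χ, x1, x2, x3, x4, x5, x6, x7⟩ := exists_cutoff (τ₁ := τ₁) (τ₃ := τ₃)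
      (a := τ₁ + 1 / ((n : ℝ) + 1)) (ε := 1 / ((n : ℝ) + 1)) hη hη0 hη2 (by linarith) hε
    have L : Loc N u l α ψ χ (ball x₀ R) J :=
      { hB := isOpen_ball, hJ := isOpen_Ioo, hl := G.hl, h0 := G.h0, h1 := G.h1
        hu := hu.2.2.1.mono (prod_mono hBΩ G.hJT), hpos := G.hpos, hψ := G.hψ, hψc := G.hψc
        hψB := G.hψA.trans G.hAB, hχ := x1, hχc := x2, hχJ := x3, hχ0 := x4 }
    have htr := G.trunc L hBΩ hu hη (fun t ht => hc t (Ioo_subset_Icc_self ht))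
      (fun t ht => hc' t (Ioo_subset_Icc_self ht)) hJf hJ0 x5 x6
    simp_rw [integral_mul_const] at htr
    change 2 * (1 - α) / α ^ 2 * (∫ t in J, γ t * χ t) ≤ _ at htr
    have hγχ : IntegrableOn (fun t => γ t * χ t) J := by
      have hi := L.grad_int
      rw [Measure.volume_eq_prod] at hi
      have hi2 : IntegrableOn (fun p : E N × ℝ =>
          ‖gradient (fun y => (u y p.2 + l) ^ (α / 2)) p.1‖ ^ 2 * ψ p.1 ^ 2 * χ p.2)
          (ball x₀ r ×ˢ J) (volume.prod volume) := hi.integrableOn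
      unfold IntegrableOn at hi2
      rw [← Measure.prod_restrict] at hi2
      have hi3 := hi2.integral_prod_right
      simp_rw [integral_mul_const] at hi3
      exact hi3
    have hle : ∫ t in J, (S n).indicator (fun t => γ t * η t) t ≤ ∫ t in J, 2 * (γ t * χ t) := by
      apply setIntegral_mono_on (hint.indicator (hSm n)) (hγχ.const_mul 2) G.hJm
      intro t ht
      by_cases hts : t ∈ S n
      · rw [indicator_of_mem hts]
        have := mul_le_mul_of_nonneg_left (x7 t hts.1 hts.2) (hγ0 t)
        linarith
      · rw [indicator_of_notMem hts]
        have := mul_nonneg (hγ0 t) (x4 t)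
        linarith
    rw [integral_const_mul] at hle
    refine hle.trans ?_
    calc 2 * ∫ t in J, γ t * χ t = α ^ 2 / (1 - α) *
          (2 * (1 - α) / α ^ 2 * ∫ t in J, γ t * χ t) := by field_simp
      _ ≤ _ := mul_le_mul_of_nonneg_left htr (by positivity)
  have hlim : Filter.Tendsto (fun n => ∫ t in J, (S n).indicator (fun t => γ t * η t) t)
      Filter.atTop (nhds (∫ t in J, γ t * η t)) := by
    apply tendsto_integral_of_dominated_convergence (fun t => |γ t * η t|)
    · intro n
      exact (hint.indicator (hSm n)).aestronglyMeasurable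
    · exact hint.abs
    · intro n
      exact Filter.Eventually.of_forall (fun t => norm_indicator_le_norm_self _ _)
    · filter_upwards [ae_restrict_mem G.hJm] with t ht
      rcases (hη0 t).eq_or_lt with h | h
      · have : ∀ n, (S n).indicator (fun t => γ t * η t) t = γ t * η t := by
          intro n
          by_cases hts : t ∈ S n
          · rw [indicator_of_mem hts]
          · rw [indicator_of_notMem hts, ← h, mul_zero]
        simp_rw [this]
        exact tendsto_const_nhds
      · have hz := tendsto_one_div_add_atTop_nhds_zero_nat (𝕜 := ℝ)
        have e1 := hz.eventually_lt_const (sub_pos.2 ht.1)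
        have e2 := hz.eventually_lt_const (by linarith : 0 < η t / 4)
        refine tendsto_const_nhds.congr' ?_
        filter_upwards [e1, e2] with n n1 n2
        have : t ∈ S n := by
          refine ⟨?_, ?_⟩
          · rw [mem_Ici]; linarith
          · rw [mem_preimage, mem_Ici]; linarith
        rw [indicator_of_mem this]
  exact le_of_tendsto' hlim hbd

theorem stmt_10 (N : ℕ) (hN : 2 ≤ N) (s Λ T : ℝ) (hs : s ∈ Set.Ioo (0 : ℝ) 1)
    (hΛ : 1 ≤ Λ) (hT : 0 < T)
    (Ω : Set (E N)) (hΩo : IsOpen Ω) (hΩb : Bornology.IsBounded Ω)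
    (K : E N → E N → ℝ → ℝ) (hK : KernelOK N s Λ T K)
    (u : E N → ℝ → ℝ) (hu : IsWeakSupersolution N T K Ω u)
    (x₀ : E N) (R r τ τ₁ τ₂ l α : ℝ)
    (hτ : 0 < τ) (hτ₁₂ : τ₁ < τ₂)
    (hsubx : Metric.ball x₀ R ⊆ Ω) (hsubt : Set.Ioo τ₁ (τ₂ + τ) ⊆ Set.Ioo 0 T)
    (hupos : ∀ x ∈ Metric.ball x₀ R, ∀ t ∈ Set.Ioo τ₁ (τ₂ + τ), 0 ≤ u x t)
    (hr : 0 < r) (hr1 : r ≤ 1) (hrR : r < R) (hl : 0 < l) (hα : α ∈ Set.Ioo (0 : ℝ) 1)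
    (ψ : E N → ℝ) (hψs : ContDiff ℝ (⊤ : ℕ∞) ψ) (hψc : HasCompactSupport ψ)
    (hψsupp : tsupport ψ ⊆ Metric.ball x₀ r) (hψ0 : ∀ x, 0 ≤ ψ x)
    (η : ℝ → ℝ) (hηs : ContDiff ℝ (⊤ : ℕ∞) η) (hη0 : ∀ t, 0 ≤ η t)
    (hη1 : ∀ t, τ₁ ≤ t → t ≤ τ₂ → η t = 1) (hη2 : ∀ t, τ₂ + τ ≤ t → η t = 0) :
    (∫ t in Set.Ioo τ₁ (τ₂ + τ), ∫ x in Metric.ball x₀ r,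
        ‖gradient (fun y => (u y t + l) ^ (α / 2)) x‖ ^ 2 * ψ x ^ 2 * η t) ≤
      (α ^ 2 / (1 - α)) *
        ((4 * (1 - α) / α + 9 / (1 - α)) *
            (∫ t in Set.Ioo τ₁ (τ₂ + τ), ∫ x in Metric.ball x₀ r, ∫ y in Metric.ball x₀ r,
              (ψ x - ψ y) ^ 2 * ((u x t + l) ^ α + (u y t + l) ^ α) * η t * K x y t)
          + 2 * Λ *
              (⨆ x ∈ tsupport ψ,
                ∫ y in (Metric.ball x₀ r)ᶜ, ‖x - y‖ ^ (-((N : ℝ) + 2 * s))) *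
              (∫ t in Set.Ioo τ₁ (τ₂ + τ), ∫ x in Metric.ball x₀ r,
                (u x t + l) ^ α * ψ x ^ 2 * η t)
          + (2 * Λ / l) *
              essSup
                (fun t => ⨆ x ∈ tsupport ψ,
                  ∫ y in (Metric.ball x₀ R)ᶜ,
                    uminus N u y t * ‖x - y‖ ^ (-((N : ℝ) + 2 * s)))
                (volume.restrict (Set.Ioo τ₁ (τ₂ + τ))) *
              (∫ t in Set.Ioo τ₁ (τ₂ + τ), ∫ x in Metric.ball x₀ r,
                (u x t + l) ^ α * ψ x ^ 2 * η t)
          + (2 / (1 - α)) *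
              (∫ t in Set.Ioo τ₁ (τ₂ + τ), ∫ x in Metric.ball x₀ r,
                (u x t + l) ^ α * ‖gradient ψ x‖ ^ 2 * η t)
          + (1 / α) *
              (∫ t in Set.Ioo τ₁ (τ₂ + τ), ∫ x in Metric.ball x₀ r,
                (u x t + l) ^ α * ψ x ^ 2 * |deriv η t|)) := by
  obtain ⟨M, hM⟩ := hu.2.1
  obtain ⟨δ, hδ0, hδ1, hδ⟩ := exists_delta hψc hψsupp
  obtain ⟨Cψ, hC0, hC, hCM⟩ := exists_Cψ hψs hψc
  have G : Glob N s Λ T K u x₀ r R (Ioo τ₁ (τ₂ + τ)) ψ l α M δ Cψ :=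
    { hN := hN, hs0 := hs.1, hs1 := hs.2, hΛ := hΛ, hK := hK, hum := hu.1, hM := hM
      hrR := hrR, hJT := hsubt, hJm := measurableSet_Ioo, hpos := hupos, hl := hl
      h0 := hα.1, h1 := hα.2, hψ := hψs, hψc := hψc, hψA := hψsupp, hδ0 := hδ0
      hδ1 := hδ1, hδ := hδ, hCψ0 := hC0, hCψ := hC, hψM := hCM }
  exact main_lim G (by linarith) hsubx hu hηs hη0 hη2
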